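/- For the Thue–Morse sequence t, the sequence n ↦ t(⌊n^c⌋) is normal over the alphabet {0,1} for every real c with 1 < c < 4/3; that is, for every T ≥ 1 and every block (ε_0, …, ε_{T−1}) ∈ {0,1}^T, the asymptotic density of n such that t(⌊(n+ℓ)^c⌋) = ε_ℓ for all ℓ < T equals 2^{−T}. -/

import Mathlib

/-- The binary sum-of-digits function. -/
def binDigitSum (n : ℕ) : ℕ := (Nat.digits 2 n).sum

/-- The Thue–Morse sequence. -/
def thueMorse (n : ℕ) : ℕ := binDigitSum n % 2

/-- The Thue–Morse sequence with values `±1`. -/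
noncomputable def tm (n : ℕ) : ℝ := (-1) ^ binDigitSum n

lemma tm_zero : tm 0 = 1 := by simp [tm, binDigitSum]

lemma tm_one : tm 1 = -1 := by simp [tm, binDigitSum]

lemma tm_mul_self (n : ℕ) : tm n * tm n = 1 := by
  unfold tm
  rw [← mul_pow]; simp

lemma abs_tm (n : ℕ) : |tm n| = 1 := by simp [tm]

lemma binDigitSum_bit (n b : ℕ) (hb : b < 2) : binDigitSum (2 * n + b) = binDigitSum n + b := by
  unfold binDigitSum
  rcases Nat.eq_zero_or_pos (2 * n + b) with h | h
  · have h1 : n = 0 := by omega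
    have h2 : b = 0 := by omega
    subst h1; subst h2; simp
  · rw [Nat.digits_def' (by norm_num) h]
    have h1 : (2 * n + b) % 2 = b := by omega
    have h2 : (2 * n + b) / 2 = n := by omega
    rw [h1, h2]; simp [add_comm]

lemma tm_bit (n b : ℕ) (hb : b < 2) : tm (2 * n + b) = tm n * (-1) ^ b := by
  unfold tm
  rw [binDigitSum_bit n b hb, pow_add]

lemma tm_add_mul (l : ℕ) : ∀ m j : ℕ, m < 2 ^ l → tm (m + 2 ^ l * j) = tm m * tm j := by
  induction l with
  | zero =>
    intro m j hm
    have : m = 0 := by simpa using hm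
    subst this; simp [tm_zero]
  | succ l ih =>
    intro m j hm
    have hb : m % 2 < 2 := Nat.mod_lt _ (by norm_num)
    have h1 : m + 2 ^ (l + 1) * j = 2 * (m / 2 + 2 ^ l * j) + m % 2 := by
      rw [pow_succ]
      have := Nat.div_add_mod m 2
      linarith [mul_assoc (2 ^ l) 2 j, mul_comm (2:ℕ) j, mul_assoc (2 ^ l) j 2]
    have h2 : m = 2 * (m / 2) + m % 2 := (Nat.div_add_mod m 2).symm
    have h3 : m / 2 < 2 ^ l := by rw [pow_succ] at hm; omega
    rw [h1, tm_bit _ _ hb, ih _ _ h3]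
    conv_rhs => rw [h2, tm_bit _ _ hb]
    ring

lemma tm_two_pow (l : ℕ) : tm (2 ^ l) = -1 := by
  have := tm_add_mul l 0 1 (by positivity)
  simpa [tm_zero, tm_one] using this

/-- The product of shifted values. -/
noncomputable def tmProd (S : Finset ℕ) (u : ℕ → ℕ) : ℝ := ∏ l ∈ S, tm (u l)

lemma abs_tmProd (S : Finset ℕ) (u : ℕ → ℕ) : |tmProd S u| = 1 := by
  unfold tmProd
  rw [Finset.abs_prod]
  simp [abs_tm]

lemma tmProd_congr (S : Finset ℕ) (u v : ℕ → ℕ) (h : ∀ l ∈ S, u l = v l) :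
    tmProd S u = tmProd S v := by
  unfold tmProd
  exact Finset.prod_congr rfl (fun l hl => by rw [h l hl])

lemma tmProd_split (S : Finset ℕ) (k : ℕ) (u : ℕ → ℕ) :
    tmProd S u = tmProd S (fun l => u l % 2 ^ k) * tmProd S (fun l => u l / 2 ^ k) := by
  unfold tmProd
  rw [← Finset.prod_mul_distrib]
  refine Finset.prod_congr rfl (fun l hl => ?_)
  rw [← tm_add_mul k _ _ (Nat.mod_lt _ (by positivity)), Nat.mod_add_div]

lemma sum_range_mul_split (a b : ℕ) (g : ℕ → ℝ) :
    ∑ x ∈ Finset.range (a * b), g x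
      = ∑ x0 ∈ Finset.range a, ∑ x1 ∈ Finset.range b, g (x0 + a * x1) := by
  induction b with
  | zero => simp
  | succ b ih =>
    rw [Nat.mul_succ, Finset.sum_range_add, ih, ← Finset.sum_add_distrib]
    refine Finset.sum_congr rfl (fun x hx => ?_)
    rw [Finset.sum_range_succ, add_comm x (a * b)]

/-- Two sets of low digits leading to the same (zero) carries with opposite signs. -/
lemma exists_cancel (S : Finset ℕ) (hS : S.Nonempty) (hE : Even S.card) :
    ∃ m : ℕ, 1 ≤ m ∧ ∀ b : ℕ → ℕ, (∀ l, b l ≤ l) →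
      ∃ x0 x1 y0 : ℕ, x0 < 2 ^ m ∧ x1 < 2 ^ m ∧ y0 < 2 ^ m ∧ x0 ≠ x1 ∧
        (∀ l ∈ S, x0 + l * y0 + b l < 2 ^ m) ∧ (∀ l ∈ S, x1 + l * y0 + b l < 2 ^ m) ∧
        tmProd S (fun l => x0 + l * y0 + b l) = - tmProd S (fun l => x1 + l * y0 + b l) := by
  set L := S.max' hS with hL
  have hLS : L ∈ S := S.max'_mem hS
  have hle : ∀ l ∈ S, l ≤ L := fun l hl => S.le_max' l hl
  obtain ⟨j, hj⟩ : ∃ j, L < 2 ^ j := ⟨L, Nat.lt_two_pow_self⟩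
  have hjpos : 0 < 2 ^ j := by positivity
  refine ⟨2 * j + 2, by omega, fun b hb => ?_⟩
  have hpow : 2 ^ (2 * j + 2) = 4 * (2 ^ j * 2 ^ j) := by
    rw [pow_add, two_mul, pow_add]; ring
  have hpow1 : 2 ^ (j + 1) = 2 * 2 ^ j := by rw [pow_succ]; ring
  have e0 : ∀ l ∈ S, 2 ^ j * (2 ^ j - L) + l * 2 ^ j + b l = b l + 2 ^ j * (2 ^ j - (L - l)) := by
    intro l hl
    have := hle l hl
    have h2 : 2 ^ j - (L - l) = (2 ^ j - L) + l := by omega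
    rw [h2]; ring
  have e1 : ∀ l ∈ S, 2 ^ j * (2 ^ (j + 1) - L) + l * 2 ^ j + b l
      = b l + 2 ^ j * (2 ^ (j + 1) - (L - l)) := by
    intro l hl
    have := hle l hl
    have h2 : 2 ^ (j + 1) - (L - l) = (2 ^ (j + 1) - L) + l := by omega
    rw [h2]; ring
  have hbl : ∀ l ∈ S, b l < 2 ^ j := fun l hl =>
    lt_of_le_of_lt ((hb l).trans (hle l hl)) hj
  have hsq : 2 ^ j ≤ 2 ^ j * 2 ^ j := Nat.le_mul_of_pos_left _ hjpos
  have b0 : 2 ^ j * (2 ^ j - L) ≤ 2 ^ j * 2 ^ j := Nat.mul_le_mul_left _ (Nat.sub_le _ _)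
  have b1 : 2 ^ j * (2 ^ (j + 1) - L) ≤ 2 ^ j * 2 ^ (j + 1) := Nat.mul_le_mul_left _ (Nat.sub_le _ _)
  have b2 : 2 ^ j * 2 ^ (j + 1) = 2 * (2 ^ j * 2 ^ j) := by rw [hpow1]; ring
  refine ⟨2 ^ j * (2 ^ j - L), 2 ^ j * (2 ^ (j + 1) - L), 2 ^ j, ?_, ?_, ?_, ?_, ?_, ?_, ?_⟩
  · omega
  · omega
  · omega
  · intro h
    have := Nat.eq_of_mul_eq_mul_left hjpos h
    omega
  · intro l hl
    rw [e0 l hl]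
    have := hbl l hl
    have h3 : 2 ^ j * (2 ^ j - (L - l)) ≤ 2 ^ j * 2 ^ j := Nat.mul_le_mul_left _ (Nat.sub_le _ _)
    omega
  · intro l hl
    rw [e1 l hl]
    have := hbl l hl
    have h3 : 2 ^ j * (2 ^ (j + 1) - (L - l)) ≤ 2 ^ j * 2 ^ (j + 1) :=
      Nat.mul_le_mul_left _ (Nat.sub_le _ _)
    omega
  · have key : ∀ l ∈ S.erase L, tm (2 ^ j * (2 ^ j - L) + l * 2 ^ j + b l)
        = (-1) * tm (2 ^ j * (2 ^ (j + 1) - L) + l * 2 ^ j + b l) := by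
      intro l hl
      have hl' := Finset.mem_of_mem_erase hl
      have hne := Finset.ne_of_mem_erase hl
      have := hle l hl'
      rw [e0 l hl', e1 l hl', tm_add_mul j _ _ (hbl l hl'), tm_add_mul j _ _ (hbl l hl')]
      have h2 : 2 ^ (j + 1) - (L - l) = (2 ^ j - (L - l)) + 2 ^ j * 1 := by omega
      rw [h2, tm_add_mul j _ _ (by omega), tm_one]; ring
    have keyL : tm (2 ^ j * (2 ^ j - L) + L * 2 ^ j + b L)
        = tm (2 ^ j * (2 ^ (j + 1) - L) + L * 2 ^ j + b L) := by
      rw [e0 L hLS, e1 L hLS, tm_add_mul j _ _ (hbl L hLS), tm_add_mul j _ _ (hbl L hLS)]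
      simp [tm_two_pow]
    unfold tmProd
    rw [← Finset.mul_prod_erase S _ hLS, ← Finset.mul_prod_erase S _ hLS, Finset.prod_congr rfl key,
      Finset.prod_mul_distrib, keyL, Finset.prod_const, Finset.card_erase_of_mem hLS]
    have hodd : Odd (S.card - 1) := by
      have := Finset.card_pos.mpr hS
      exact Nat.Even.sub_odd (by omega) hE odd_one
    rw [hodd.neg_one_pow]; ring

lemma contraction (S : Finset ℕ) (m : ℕ) (hm1 : 1 ≤ m)
    (hm : ∀ b : ℕ → ℕ, (∀ l, b l ≤ l) →
      ∃ x0 x1 y0 : ℕ, x0 < 2 ^ m ∧ x1 < 2 ^ m ∧ y0 < 2 ^ m ∧ x0 ≠ x1 ∧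
        (∀ l ∈ S, x0 + l * y0 + b l < 2 ^ m) ∧ (∀ l ∈ S, x1 + l * y0 + b l < 2 ^ m) ∧
        tmProd S (fun l => x0 + l * y0 + b l) = - tmProd S (fun l => x1 + l * y0 + b l)) (t : ℕ) :
    ∀ b h : ℕ → ℕ, (∀ l, b l ≤ l) →
      |∑ x ∈ Finset.range (2 ^ (m * t)), ∑ y ∈ Finset.range (2 ^ (m * t)),
        tmProd S (fun l => x + l * y + b l + 2 ^ (m * t) * h l)| ≤ ((4:ℝ) ^ m - 2) ^ t := by
  induction t with
  | zero =>
    intro b h hb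
    simp [abs_tmProd]
  | succ t ih =>
    intro b h hb
    set W := 2 ^ (m * t) with hW
    have hpow : 2 ^ (m * (t + 1)) = 2 ^ m * W := by rw [hW, ← pow_add]; congr 1; ring
    rw [hpow]
    set c : ℕ → ℕ → ℕ → ℕ := fun x0 y0 l => (x0 + l * y0 + b l) / 2 ^ m with hc
    have hcl : ∀ x0 y0, x0 < 2 ^ m → y0 < 2 ^ m → ∀ l, c x0 y0 l ≤ l := by
      intro x0 y0 hx hy l
      have h1 : x0 + l * y0 + b l < 2 ^ m * (l + 1) := by
        have h2 : l * y0 + l ≤ l * 2 ^ m := by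
          have : l * (y0 + 1) ≤ l * 2 ^ m := Nat.mul_le_mul_left _ hy
          linarith
        have := hb l
        nlinarith
      have := Nat.div_lt_of_lt_mul h1
      simp only [hc]; omega
    set σ : ℕ → ℕ → ℝ := fun x0 y0 => tmProd S (fun l => (x0 + l * y0 + b l) % 2 ^ m) with hσ
    set Φ : (ℕ → ℕ) → ℝ := fun e => ∑ x1 ∈ Finset.range W, ∑ y1 ∈ Finset.range W,
        tmProd S (fun l => x1 + l * y1 + e l + W * h l) with hΦ
    have hre : ∑ x ∈ Finset.range (2 ^ m * W), ∑ y ∈ Finset.range (2 ^ m * W),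
        tmProd S (fun l => x + l * y + b l + 2 ^ m * W * h l)
        = ∑ x0 ∈ Finset.range (2 ^ m), ∑ y0 ∈ Finset.range (2 ^ m), σ x0 y0 * Φ (c x0 y0) := by
      rw [sum_range_mul_split]
      refine Finset.sum_congr rfl (fun x0 hx0 => ?_)
      have : ∀ x1 ∈ Finset.range W, ∑ y ∈ Finset.range (2 ^ m * W),
          tmProd S (fun l => x0 + 2 ^ m * x1 + l * y + b l + 2 ^ m * W * h l)
          = ∑ y0 ∈ Finset.range (2 ^ m), ∑ y1 ∈ Finset.range W,
            tmProd S (fun l => x0 + 2 ^ m * x1 + l * (y0 + 2 ^ m * y1) + b l + 2 ^ m * W * h l) :=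
        fun x1 _ => sum_range_mul_split _ _ _
      rw [Finset.sum_congr rfl this, Finset.sum_comm]
      refine Finset.sum_congr rfl (fun y0 hy0 => ?_)
      simp only [hΦ, hσ]
      rw [Finset.mul_sum]
      refine Finset.sum_congr rfl (fun x1 hx1 => ?_)
      rw [Finset.mul_sum]
      refine Finset.sum_congr rfl (fun y1 hy1 => ?_)
      rw [tmProd_split S m]
      have e : ∀ l, x0 + 2 ^ m * x1 + l * (y0 + 2 ^ m * y1) + b l + 2 ^ m * W * h l
          = (x0 + l * y0 + b l) + 2 ^ m * (x1 + l * y1 + W * h l) := fun l => by ring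
      congr 1
      · exact tmProd_congr _ _ _ (fun l _ => by rw [e, Nat.add_mul_mod_self_left])
      · refine tmProd_congr _ _ _ (fun l _ => ?_)
        rw [e, Nat.add_mul_div_left _ _ (by positivity)]
        simp only [hc]; ring
    rw [hre, ← Finset.sum_product']
    obtain ⟨x0, x1, y0, hx0, hx1, hy0, hne, hz0, hz1, hprod⟩ := hm b hb
    set U := Finset.range (2 ^ m) ×ˢ Finset.range (2 ^ m) with hU
    have m0 : (x0, y0) ∈ U := by simp [hU, hx0, hy0]
    have m1 : (x1, y0) ∈ U.erase (x0, y0) := by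
      rw [Finset.mem_erase]
      refine ⟨?_, by simp [hU, hx1, hy0]⟩
      intro hh
      exact hne (Prod.mk.inj hh).1.symm
    rw [← Finset.add_sum_erase U _ m0, ← Finset.add_sum_erase _ _ m1, ← add_assoc]
    have hc0 : Φ (c x0 y0) = Φ (fun _ => 0) := by
      simp only [hΦ]
      refine Finset.sum_congr rfl (fun _ _ => Finset.sum_congr rfl (fun _ _ => ?_))
      refine tmProd_congr _ _ _ (fun l hl => ?_)
      simp only [hc, Nat.div_eq_of_lt (hz0 l hl)]
    have hc1 : Φ (c x1 y0) = Φ (fun _ => 0) := by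
      simp only [hΦ]
      refine Finset.sum_congr rfl (fun _ _ => Finset.sum_congr rfl (fun _ _ => ?_))
      refine tmProd_congr _ _ _ (fun l hl => ?_)
      simp only [hc, Nat.div_eq_of_lt (hz1 l hl)]
    have hs : σ x0 y0 = - σ x1 y0 := by
      simp only [hσ]
      rw [tmProd_congr S (fun l => (x0 + l * y0 + b l) % 2 ^ m) _
          (fun l hl => Nat.mod_eq_of_lt (hz0 l hl)),
        tmProd_congr S (fun l => (x1 + l * y0 + b l) % 2 ^ m) _
          (fun l hl => Nat.mod_eq_of_lt (hz1 l hl))]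
      exact hprod
    have hzero : σ x0 y0 * Φ (c x0 y0) + σ x1 y0 * Φ (c x1 y0) = 0 := by
      rw [hc0, hc1, hs]; ring
    simp only [hzero, zero_add]
    have hbd : ∀ p ∈ (U.erase (x0, y0)).erase (x1, y0),
        |σ p.1 p.2 * Φ (c p.1 p.2)| ≤ ((4:ℝ) ^ m - 2) ^ t := by
      intro p hp
      have hpU : p ∈ U := Finset.mem_of_mem_erase (Finset.mem_of_mem_erase hp)
      simp only [hU, Finset.mem_product, Finset.mem_range] at hpU
      rw [abs_mul]
      have : |σ p.1 p.2| = 1 := abs_tmProd _ _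
      rw [this, one_mul]
      exact ih _ _ (hcl _ _ hpU.1 hpU.2)
    refine (Finset.abs_sum_le_sum_abs _ _).trans ((Finset.sum_le_sum hbd).trans ?_)
    rw [Finset.sum_const, nsmul_eq_mul, Finset.card_erase_of_mem m1, Finset.card_erase_of_mem m0]
    have hcard : U.card = 4 ^ m := by
      simp [hU, ← mul_pow]
    have h4 : 4 ≤ 4 ^ m := by
      calc 4 = 4 ^ 1 := by norm_num
        _ ≤ 4 ^ m := Nat.pow_le_pow_right (by norm_num) hm1
    rw [hcard, Nat.sub_sub, Nat.cast_sub (by omega)]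
    push_cast
    rw [pow_succ]
    apply le_of_eq; ring


lemma contraction_shift (S : Finset ℕ) (m : ℕ) (d t : ℕ)
    (hcon : ∀ b h : ℕ → ℕ, (∀ l, b l ≤ l) →
      |∑ x ∈ Finset.range (2 ^ (m * t)), ∑ y ∈ Finset.range (2 ^ (m * t)),
        tmProd S (fun l => x + l * y + b l + 2 ^ (m * t) * h l)| ≤ ((4:ℝ) ^ m - 2) ^ t)
    (h : ℕ → ℕ) :
    |∑ x ∈ Finset.range (2 ^ d * 2 ^ (m * t)), ∑ y ∈ Finset.range (2 ^ d * 2 ^ (m * t)),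
        tmProd S (fun l => (x + l * y + 2 ^ d * 2 ^ (m * t) * h l) / 2 ^ d)|
      ≤ 4 ^ d * ((4:ℝ) ^ m - 2) ^ t := by
  set W := 2 ^ (m * t) with hW
  have hre : ∑ x ∈ Finset.range (2 ^ d * W), ∑ y ∈ Finset.range (2 ^ d * W),
      tmProd S (fun l => (x + l * y + 2 ^ d * W * h l) / 2 ^ d)
      = ∑ x0 ∈ Finset.range (2 ^ d), ∑ y0 ∈ Finset.range (2 ^ d),
        ∑ x1 ∈ Finset.range W, ∑ y1 ∈ Finset.range W,
          tmProd S (fun l => x1 + l * y1 + (x0 + l * y0) / 2 ^ d + W * h l) := by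
    rw [sum_range_mul_split]
    refine Finset.sum_congr rfl (fun x0 hx0 => ?_)
    rw [Finset.sum_congr rfl (fun x1 _ => sum_range_mul_split (2 ^ d) W
      (fun y => tmProd S (fun l => (x0 + 2 ^ d * x1 + l * y + 2 ^ d * W * h l) / 2 ^ d))),
      Finset.sum_comm]
    refine Finset.sum_congr rfl (fun y0 hy0 => ?_)
    refine Finset.sum_congr rfl (fun x1 hx1 => ?_)
    refine Finset.sum_congr rfl (fun y1 hy1 => ?_)
    refine tmProd_congr _ _ _ (fun l _ => ?_)
    have e : x0 + 2 ^ d * x1 + l * (y0 + 2 ^ d * y1) + 2 ^ d * W * h l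
        = (x0 + l * y0) + 2 ^ d * (x1 + l * y1 + W * h l) := by ring
    rw [e, Nat.add_mul_div_left _ _ (by positivity)]
    ring
  rw [hre]
  have hb : ∀ x0 ∈ Finset.range (2 ^ d), ∀ y0 ∈ Finset.range (2 ^ d),
      |∑ x1 ∈ Finset.range W, ∑ y1 ∈ Finset.range W,
          tmProd S (fun l => x1 + l * y1 + (x0 + l * y0) / 2 ^ d + W * h l)|
        ≤ ((4:ℝ) ^ m - 2) ^ t := by
    intro x0 hx0 y0 hy0
    rw [Finset.mem_range] at hx0 hy0
    refine hcon (fun l => (x0 + l * y0) / 2 ^ d) h (fun l => ?_)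
    have h1 : x0 + l * y0 < 2 ^ d * (l + 1) := by
      have : l * y0 ≤ l * 2 ^ d := Nat.mul_le_mul_left _ hy0.le
      nlinarith
    have := Nat.div_lt_of_lt_mul h1
    show (x0 + l * y0) / 2 ^ d ≤ l
    omega
  calc _ ≤ ∑ x0 ∈ Finset.range (2 ^ d), ∑ y0 ∈ Finset.range (2 ^ d), ((4:ℝ) ^ m - 2) ^ t := by
        refine (Finset.abs_sum_le_sum_abs _ _).trans (Finset.sum_le_sum (fun x0 hx0 => ?_))
        exact (Finset.abs_sum_le_sum_abs _ _).trans (Finset.sum_le_sum (fun y0 hy0 => hb x0 hx0 y0 hy0))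
    _ = 4 ^ d * ((4:ℝ) ^ m - 2) ^ t := by
        simp only [Finset.sum_const, Finset.card_range, nsmul_eq_mul, Nat.cast_pow, Nat.cast_ofNat]
        rw [← mul_assoc, ← mul_pow]; norm_num

/-- Sum over a full period in the first variable. -/
noncomputable def tmJ (S : Finset ℕ) (d l j : ℕ) : ℝ :=
  ∑ i ∈ Finset.range (2 ^ l * 2 ^ d), tmProd S (fun x => (i + x * j) / 2 ^ d)

lemma abs_sum_tmProd_le (S : Finset ℕ) (n : ℕ) (u : ℕ → ℕ → ℕ) :
    |∑ i ∈ Finset.range n, tmProd S (u i)| ≤ n := by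
  refine (Finset.abs_sum_le_sum_abs _ _).trans ?_
  simp [abs_tmProd]

lemma abs_tmJ_le (S : Finset ℕ) (d l j : ℕ) : |tmJ S d l j| ≤ 2 ^ l * 2 ^ d := by
  have := abs_sum_tmProd_le S (2 ^ l * 2 ^ d) (fun i x => (i + x * j) / 2 ^ d)
  simpa [tmJ] using this

lemma tmJ_aligned (S : Finset ℕ) (m : ℕ) (d t l : ℕ) (hl : m * t ≤ l)
    (hcon : ∀ h : ℕ → ℕ,
      |∑ x ∈ Finset.range (2 ^ d * 2 ^ (m * t)), ∑ y ∈ Finset.range (2 ^ d * 2 ^ (m * t)),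
        tmProd S (fun l => (x + l * y + 2 ^ d * 2 ^ (m * t) * h l) / 2 ^ d)|
      ≤ 4 ^ d * ((4:ℝ) ^ m - 2) ^ t) (z : ℕ) :
    |∑ y ∈ Finset.range (2 ^ d * 2 ^ (m * t)), tmJ S d l (2 ^ d * 2 ^ (m * t) * z + y)|
      ≤ (1 - 2 / 4 ^ m) ^ t * (2 ^ d * 2 ^ (m * t)) * (2 ^ l * 2 ^ d) := by
  obtain ⟨r, rfl⟩ := Nat.exists_eq_add_of_le hl
  set V := 2 ^ d * 2 ^ (m * t) with hV
  have hR : 2 ^ (m * t + r) * 2 ^ d = V * 2 ^ r := by rw [hV, pow_add]; ring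
  have hre : ∑ y ∈ Finset.range V, tmJ S d (m * t + r) (V * z + y)
      = ∑ i1 ∈ Finset.range (2 ^ r), ∑ x ∈ Finset.range V, ∑ y ∈ Finset.range V,
        tmProd S (fun l => (x + l * y + V * (i1 + l * z)) / 2 ^ d) := by
    unfold tmJ
    rw [hR, Finset.sum_congr rfl (fun y _ => sum_range_mul_split V (2 ^ r) _), Finset.sum_comm]
    rw [Finset.sum_congr rfl (fun x _ => Finset.sum_comm), Finset.sum_comm]
    refine Finset.sum_congr rfl (fun i1 _ => ?_)
    refine Finset.sum_congr rfl (fun x _ => ?_)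
    refine Finset.sum_congr rfl (fun y _ => ?_)
    refine tmProd_congr _ _ _ (fun l _ => ?_)
    congr 1; ring
  rw [hre]
  refine (Finset.abs_sum_le_sum_abs _ _).trans
    ((Finset.sum_le_sum (fun i1 _ => hcon (fun l => i1 + l * z))).trans ?_)
  rw [Finset.sum_const, Finset.card_range, nsmul_eq_mul]
  apply le_of_eq
  have h4 : (4:ℝ) ^ m ≠ 0 := by positivity
  have e1 : (4:ℝ) ^ m - 2 = 4 ^ m * (1 - 2 / 4 ^ m) := by field_simp
  rw [e1, mul_pow, ← pow_mul]
  have e2 : (4:ℝ) ^ d = 2 ^ d * 2 ^ d := by rw [← mul_pow]; norm_num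
  have e3 : (4:ℝ) ^ (m * t) = 2 ^ (m * t) * 2 ^ (m * t) := by rw [← mul_pow]; norm_num
  rw [e2, e3]
  push_cast
  rw [pow_add]; ring

lemma sum_shift (g : ℕ → ℝ) (C : ℝ) (hg : ∀ n, |g n| ≤ C) (n e : ℕ) :
    |∑ s ∈ Finset.range n, g (s + e) - ∑ s ∈ Finset.range n, g s| ≤ 2 * e * C := by
  have h1 := Finset.sum_range_add g e n
  have h2 := Finset.sum_range_add g n e
  rw [add_comm e n] at h1
  have h3 : ∑ s ∈ Finset.range n, g (s + e) = ∑ s ∈ Finset.range n, g (e + s) :=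
    Finset.sum_congr rfl (fun s _ => by rw [add_comm])
  have h4 : |∑ x ∈ Finset.range e, g x| ≤ e * C := by
    refine (Finset.abs_sum_le_sum_abs _ _).trans ((Finset.sum_le_sum (fun i _ => hg i)).trans ?_)
    simp
  have h5 : |∑ x ∈ Finset.range e, g (n + x)| ≤ e * C := by
    refine (Finset.abs_sum_le_sum_abs _ _).trans ((Finset.sum_le_sum (fun i _ => hg _)).trans ?_)
    simp
  rw [h3]
  have : ∑ s ∈ Finset.range n, g (e + s) - ∑ s ∈ Finset.range n, g s
      = ∑ x ∈ Finset.range e, g (n + x) - ∑ x ∈ Finset.range e, g x := by linarith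
  rw [this]
  rw [abs_le] at *
  constructor <;> linarith [h4.1, h4.2, h5.1, h5.2]

lemma window_bound (g : ℕ → ℝ) (C c : ℝ) (hg : ∀ n, |g n| ≤ C) (hC : 0 ≤ C) (V : ℕ) (hV : 0 < V)
    (hal : ∀ z, |∑ y ∈ Finset.range V, g (V * z + y)| ≤ c) (B j : ℕ) :
    |∑ s ∈ Finset.range (V * B), g (j + s)| ≤ B * c + 2 * V * C := by
  have hr : j % V < V := Nat.mod_lt _ hV
  have hj := Nat.div_add_mod j V
  set z := j / V
  set e := V - j % V with he
  have h1 := sum_shift (fun s => g (j + s)) C (fun n => hg _) (V * B) e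
  have h2 : ∑ s ∈ Finset.range (V * B), g (j + (s + e))
      = ∑ b ∈ Finset.range B, ∑ y ∈ Finset.range V, g (V * (z + 1 + b) + y) := by
    rw [sum_range_mul_split, Finset.sum_comm]
    refine Finset.sum_congr rfl (fun b _ => Finset.sum_congr rfl (fun y _ => ?_))
    congr 1
    have : V * (z + 1 + b) = V * z + V + V * b := by ring
    omega
  have h3 : |∑ s ∈ Finset.range (V * B), g (j + (s + e))| ≤ B * c := by
    rw [h2]
    refine (Finset.abs_sum_le_sum_abs _ _).trans ((Finset.sum_le_sum (fun i _ => hal _)).trans ?_)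
    simp
  have h4 : 2 * (e:ℝ) * C ≤ 2 * V * C := by
    have : (e:ℝ) ≤ V := by exact_mod_cast Nat.sub_le _ _
    nlinarith
  rw [abs_le] at *
  constructor <;> linarith [h1.1, h1.2, h3.1, h3.2]

lemma card_residue (P D e : ℕ) (hD : 0 < D) (T : Finset ℕ) :
    ((Finset.range (P * D)).filter (fun i => (i + e) % D ∈ T)).card ≤ P * T.card := by
  have : ((Finset.range P) ×ˢ T).card = P * T.card := by simp
  rw [← this]
  refine Finset.card_le_card_of_injOn (fun i => (i / D, (i + e) % D)) ?_ ?_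
  · intro i hi
    simp only [Finset.coe_filter, Finset.mem_range, Set.mem_setOf_eq] at hi
    simp only [Finset.coe_product, Set.mem_prod, Finset.coe_range, Set.mem_Iio, Finset.mem_coe]
    exact ⟨Nat.div_lt_of_lt_mul (by rw [mul_comm]; exact hi.1), hi.2⟩
  · intro i _ i' _ h
    simp only [Prod.mk.injEq] at h
    have h1 : i ≡ i' [MOD D] := Nat.ModEq.add_right_cancel' e h.2
    have h2 : i % D = i' % D := h1
    rw [← Nat.div_add_mod i D, ← Nat.div_add_mod i' D, h.1, h2]

lemma card_residue_union (S : Finset ℕ) (P D j : ℕ) (hD : 0 < D) (T : Finset ℕ) :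
    ((Finset.range (P * D)).filter (fun i => ∃ l ∈ S, (i + l * j) % D ∈ T)).card
      ≤ S.card * (P * T.card) := by
  have hsub : (Finset.range (P * D)).filter (fun i => ∃ l ∈ S, (i + l * j) % D ∈ T)
      ⊆ S.biUnion (fun l => (Finset.range (P * D)).filter (fun i => (i + l * j) % D ∈ T)) := by
    intro i hi
    simp only [Finset.mem_filter, Finset.mem_biUnion] at *
    obtain ⟨h1, l, h2, h3⟩ := hi
    exact ⟨l, h2, h1, h3⟩
  refine (Finset.card_le_card hsub).trans (Finset.card_biUnion_le.trans ?_)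
  refine (Finset.sum_le_sum (fun l _ => card_residue P D (l * j) hD T)).trans ?_
  simp

/-- Residues close to the top. -/
def topRes (D r : ℕ) : Finset ℕ := (Finset.range D).filter (fun x => D < x + r)

lemma card_topRes (D r : ℕ) : (topRes D r).card ≤ r - 1 := by
  have : topRes D r ⊆ Finset.Ico (D + 1 - r) D := by
    intro x hx
    simp only [topRes, Finset.mem_filter, Finset.mem_range, Finset.mem_Ico] at *
    omega
  refine (Finset.card_le_card this).trans ?_
  rw [Nat.card_Ico]; omega

lemma tmJ_lip (S : Finset ℕ) (L : ℕ) (hL : ∀ l ∈ S, l ≤ L) (d l j : ℕ) :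
    |tmJ S d l (j + 1) - tmJ S d l j| ≤ 2 * (S.card * L * 2 ^ l) := by
  unfold tmJ
  rw [← Finset.sum_sub_distrib]
  set D := 2 ^ d with hD
  have hDpos : 0 < D := by positivity
  set bad := (Finset.range (2 ^ l * D)).filter (fun i => ∃ x ∈ S, (i + x * j) % D ∈ topRes D (L + 1))
    with hbad
  have hle : ∀ i ∈ Finset.range (2 ^ l * D),
      |tmProd S (fun x => (i + x * (j + 1)) / D) - tmProd S (fun x => (i + x * j) / D)|
        ≤ if (∃ x ∈ S, (i + x * j) % D ∈ topRes D (L + 1)) then 2 else 0 := by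
    intro i hi
    split_ifs with h
    · refine (abs_sub _ _).trans ?_
      rw [abs_tmProd, abs_tmProd]; norm_num
    · push Not at h
      rw [tmProd_congr S (fun x => (i + x * (j + 1)) / D) (fun x => (i + x * j) / D)]
      · simp
      · intro x hx
        have h1 := h x hx
        have hlt := Nat.mod_lt (i + x * j) hDpos
        simp only [topRes, Finset.mem_filter, Finset.mem_range, not_and, not_lt] at h1
        have h2 := h1 hlt
        have h3 := hL x hx
        have e : i + x * (j + 1) = ((i + x * j) % D + x) + D * ((i + x * j) / D) := by
          have := Nat.mod_add_div (i + x * j) D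
          rw [mul_add, mul_one]; omega
        show (i + x * (j + 1)) / D = (i + x * j) / D
        rw [e, Nat.add_mul_div_left _ _ hDpos, Nat.div_eq_of_lt (by omega), zero_add]
  refine (Finset.abs_sum_le_sum_abs _ _).trans ((Finset.sum_le_sum hle).trans ?_)
  rw [← Finset.sum_filter, Finset.sum_const, nsmul_eq_mul]
  have hc : bad.card ≤ S.card * L * 2 ^ l := by
    refine (card_residue_union S (2 ^ l) D j hDpos (topRes D (L + 1))).trans ?_
    have := card_topRes D (L + 1)
    calc _ ≤ S.card * (2 ^ l * L) := by gcongr; simpa using this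
      _ = _ := by ring
  have hc' : (bad.card : ℝ) ≤ S.card * L * 2 ^ l := by exact_mod_cast hc
  rw [← hbad]
  linarith


lemma int_card_le (T : Finset ℤ) (z : ℝ) (hz : 0 ≤ z)
    (h : ∀ a ∈ T, ∀ b ∈ T, (a:ℝ) - b ≤ z) : (T.card : ℝ) ≤ z + 1 := by
  rcases T.eq_empty_or_nonempty with rfl | hne
  · simp; linarith
  · have hsub : T ⊆ Finset.Icc (T.min' hne) (T.max' hne) := by
      intro x hx
      rw [Finset.mem_Icc]
      exact ⟨T.min'_le x hx, T.le_max' x hx⟩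
    have h1 := Finset.card_le_card hsub
    rw [Int.card_Icc] at h1
    have h2 := h _ (T.max'_mem hne) _ (T.min'_mem hne)
    have h3 : T.min' hne ≤ T.max' hne := T.min'_le _ (T.max'_mem hne)
    have h4 : (T.card : ℤ) ≤ T.max' hne + 1 - T.min' hne := by omega
    have h5 : (T.card : ℝ) ≤ T.max' hne + 1 - T.min' hne := by exact_mod_cast h4
    linarith

lemma nat_card_le (T : Finset ℕ) (z : ℝ) (hz : 0 ≤ z)
    (h : ∀ a ∈ T, ∀ b ∈ T, (a:ℝ) - b ≤ z) : (T.card : ℝ) ≤ z + 1 := by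
  have := int_card_le (T.image (fun n : ℕ => (n:ℤ))) z hz (by
    intro a ha b hb
    simp only [Finset.mem_image] at ha hb
    obtain ⟨a', ha', rfl⟩ := ha
    obtain ⟨b', hb', rfl⟩ := hb
    exact_mod_cast h a' ha' b' hb')
  rwa [Finset.card_image_of_injective _ Nat.cast_injective] at this

/-- The cell of the `k`-th point. -/
noncomputable def cell (P D : ℕ) (X α : ℝ) (k : ℕ) : ℕ := ⌊(D:ℝ) * (X + k * α)⌋₊ % (P * D)

lemma chunk_count (P D q : ℕ) (hP : 0 < P) (hD : 0 < D) (hq : 0 < q) (X α : ℝ) (hX : 0 ≤ X)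
    (hα : 0 ≤ α) (a : ℤ) (hco : IsCoprime (q:ℤ) a) (ha : |q * (α / P) - a| ≤ 1 / q) (i k0 : ℕ) :
    (((Finset.range q).filter (fun k => cell P D X α (k0 + k) = i)).card : ℝ)
      ≤ q / (P * D) + 2 := by
  set w : ℕ → ℕ := fun k => ⌊(D:ℝ) * (X + (k0 + k : ℕ) * α)⌋₊ / (P * D) with hw
  set v : ℕ → ℤ := fun k => (k0 + k : ℕ) * a - q * w k with hv
  set F := (Finset.range q).filter (fun k => cell P D X α (k0 + k) = i) with hF
  have hPr : (0:ℝ) < P := by exact_mod_cast hP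
  have hDr : (0:ℝ) < D := by exact_mod_cast hD
  have hqr : (0:ℝ) < q := by exact_mod_cast hq
  have hinj : Set.InjOn v F := by
    intro k hk k' hk' h
    simp only [hF, Finset.coe_filter, Finset.mem_range, Set.mem_setOf_eq] at hk hk'
    simp only [hv] at h
    have h1 : (q:ℤ) ∣ a * ((k:ℤ) - k') := by
      refine ⟨w k - w k', ?_⟩
      push_cast at h
      linarith
    have h2 : (q:ℤ) ∣ (k:ℤ) - k' := hco.dvd_of_dvd_mul_left h1
    have h3 : (k:ℤ) - k' = 0 := by
      refine Int.eq_zero_of_abs_lt_dvd h2 ?_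
      rw [abs_lt]; constructor <;> omega
    omega
  rw [← Finset.card_image_of_injOn hinj]
  have hz : (0:ℝ) ≤ q / (P * D) + 1 := by positivity
  refine (int_card_le _ _ hz ?_).trans (by linarith)
  have hpt : ∀ k ∈ F, ∃ r : ℝ, 0 ≤ r ∧ r < q / (P * D) ∧
      (v k : ℝ) + k * (q * (α / P) - a) = (q * i / (P * D) - q * X / P - k0 * (q * (α / P) - a)) + r := by
    intro k hk
    simp only [hF, Finset.mem_filter, Finset.mem_range] at hk
    set u := ⌊(D:ℝ) * (X + (k0 + k : ℕ) * α)⌋₊ with hu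
    have hui : u = i + P * D * w k := by
      have := Nat.mod_add_div u (P * D)
      rw [← this]
      simp only [hw]
      rw [← hk.2]; rfl
    have hnn : 0 ≤ (D:ℝ) * (X + (k0 + k : ℕ) * α) := by positivity
    have h1 := Nat.floor_le hnn
    have h2 := Nat.lt_floor_add_one ((D:ℝ) * (X + (k0 + k : ℕ) * α))
    rw [← hu] at h1 h2
    refine ⟨q / (P * D) * ((D:ℝ) * (X + (k0 + k : ℕ) * α) - u), ?_, ?_, ?_⟩
    · apply mul_nonneg (by positivity); linarith
    · have : (D:ℝ) * (X + (k0 + k : ℕ) * α) - u < 1 := by linarith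
      have h0 : (0:ℝ) < q / (P * D) := by positivity
      nlinarith
    · rw [hui]
      simp only [hv]
      push_cast
      field_simp
      ring
  intro x hx y hy
  simp only [Finset.mem_image] at hx hy
  obtain ⟨k, hk, rfl⟩ := hx
  obtain ⟨k', hk', rfl⟩ := hy
  obtain ⟨r, hr0, hr1, hr⟩ := hpt k hk
  obtain ⟨r', hr0', hr1', hr'⟩ := hpt k' hk'
  simp only [hF, Finset.mem_filter, Finset.mem_range] at hk hk'
  have hdiff : ((k':ℝ) - k) * (q * (α / P) - a) ≤ 1 := by
    refine (le_abs_self _).trans ?_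
    rw [abs_mul]
    have : |(k':ℝ) - k| ≤ q := by
      have h1 : (k:ℝ) < q := by exact_mod_cast hk.1
      have h2 : (k':ℝ) < q := by exact_mod_cast hk'.1
      have h3 : (0:ℝ) ≤ k := Nat.cast_nonneg _
      have h4 : (0:ℝ) ≤ k' := Nat.cast_nonneg _
      rw [abs_le]; constructor <;> linarith
    calc _ ≤ (q:ℝ) * (1 / q) := mul_le_mul this ha (abs_nonneg _) hqr.le
      _ = 1 := by field_simp
  linarith

lemma block_count (P D q K : ℕ) (hP : 0 < P) (hD : 0 < D) (hq : 0 < q) (X α : ℝ) (hX : 0 ≤ X)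
    (hα : 0 ≤ α) (a : ℤ) (hco : IsCoprime (q:ℤ) a) (ha : |q * (α / P) - a| ≤ 1 / q) (i : ℕ) :
    (((Finset.range K).filter (fun k => cell P D X α k = i)).card : ℝ)
      ≤ ((K:ℝ) / q + 1) * (q / (P * D) + 2) := by
  have hsub : (Finset.range K).filter (fun k => cell P D X α k = i) ⊆
      (Finset.range (K / q + 1)).biUnion (fun b =>
        ((Finset.range q).filter (fun k => cell P D X α (q * b + k) = i)).image
          (fun k => q * b + k)) := by
    intro k hk
    simp only [Finset.mem_filter, Finset.mem_range, Finset.mem_biUnion, Finset.mem_image] at *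
    refine ⟨k / q, ?_, k % q, ⟨Nat.mod_lt _ hq, ?_⟩, Nat.div_add_mod k q⟩
    · have := Nat.div_le_div_right (c := q) hk.1.le
      omega
    · rw [Nat.div_add_mod]; exact hk.2
  have h1 := (Finset.card_le_card hsub).trans Finset.card_biUnion_le
  have h2 : (((Finset.range K).filter (fun k => cell P D X α k = i)).card : ℝ)
      ≤ ∑ b ∈ Finset.range (K / q + 1), ((q:ℝ) / (P * D) + 2) := by
    calc _ ≤ ((∑ b ∈ Finset.range (K / q + 1),
          (((Finset.range q).filter (fun k => cell P D X α (q * b + k) = i)).image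
          (fun k => q * b + k)).card : ℕ) : ℝ) := by exact_mod_cast h1
      _ ≤ _ := by
        push_cast
        refine Finset.sum_le_sum (fun b _ => ?_)
        refine le_trans ?_ (chunk_count P D q hP hD hq X α hX hα a hco ha i (q * b))
        exact_mod_cast Finset.card_image_le
  refine h2.trans ?_
  rw [Finset.sum_const, Finset.card_range, nsmul_eq_mul]
  have h3 : ((K / q + 1 : ℕ) : ℝ) ≤ (K:ℝ) / q + 1 := by
    push_cast
    have := @Nat.cast_div_le ℝ _ _ _ K q
    linarith
  gcongr

/-- Abstract comparison of a sum over points with an average over cells. -/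
lemma cell_compare (R K : ℕ) (hR : 0 < R) (ce : ℕ → ℕ) (hce : ∀ k, ce k < R) (F W : ℕ → ℝ)
    (hF : ∀ k, |F k| ≤ 1) (hW : ∀ k, |W k| ≤ 1) (bad : Finset ℕ)
    (hgood : ∀ k < K, ce k ∉ bad → F k = W (ce k)) (hbad : bad ⊆ Finset.range R) (U : ℝ)
    (hU : ∀ i, (((Finset.range K).filter (fun k => ce k = i)).card : ℝ) ≤ U)
    (hUK : (K:ℝ) / R ≤ U) :
    |∑ k ∈ Finset.range K, F k - (K:ℝ) / R * ∑ i ∈ Finset.range R, W i|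
      ≤ 2 * (R * U - K) + 2 * bad.card * (K / R) := by
  have hRr : (0:ℝ) < R := by exact_mod_cast hR
  set N : ℕ → ℝ := fun i => (((Finset.range K).filter (fun k => ce k = i)).card : ℝ) with hN
  have hmaps : ∀ k ∈ Finset.range K, ce k ∈ Finset.range R := fun k _ => Finset.mem_range.mpr (hce k)
  have hNsum : ∑ i ∈ Finset.range R, N i = K := by
    have := Finset.card_eq_sum_card_fiberwise (f := ce) (s := Finset.range K) (t := Finset.range R)
      (fun k hk => hmaps k hk)
    rw [Finset.card_range] at this
    simp only [hN]
    exact_mod_cast this.symm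
  rw [← Finset.sum_fiberwise_of_maps_to hmaps F, Finset.mul_sum, ← Finset.sum_sub_distrib]
  have hpt : ∀ i ∈ Finset.range R,
      |∑ k ∈ Finset.range K with ce k = i, F k - (K:ℝ) / R * W i|
        ≤ (2 * (U - K / R) - (N i - K / R)) + (if i ∈ bad then 2 * ((K:ℝ) / R) else 0) := by
    intro i hi
    have hK0 : (0:ℝ) ≤ K / R := by positivity
    have habs : |N i - K / R| ≤ 2 * (U - K / R) - (N i - K / R) := by
      have h1 : N i ≤ U := hU i
      rw [abs_le]; constructor <;> linarith
    split_ifs with hib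
    · have h1 : |∑ k ∈ Finset.range K with ce k = i, F k| ≤ N i := by
        refine (Finset.abs_sum_le_sum_abs _ _).trans ((Finset.sum_le_sum (fun k _ => hF k)).trans ?_)
        simp [hN]
      have h2 : |(K:ℝ) / R * W i| ≤ K / R := by
        rw [abs_mul, abs_of_nonneg hK0]
        nlinarith [hW i]
      have h3 := abs_sub (∑ k ∈ Finset.range K with ce k = i, F k) ((K:ℝ) / R * W i)
      have h4 := le_abs_self (N i - K / R)
      linarith
    · have h1 : ∑ k ∈ Finset.range K with ce k = i, F k = N i * W i := by
        rw [Finset.sum_congr rfl (g := fun _ => W i)]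
        · rw [Finset.sum_const, nsmul_eq_mul]
        · intro k hk
          simp only [Finset.mem_filter, Finset.mem_range] at hk
          rw [hgood k hk.1 (by rw [hk.2]; exact hib), hk.2]
      rw [h1, ← sub_mul, abs_mul]
      have := hW i
      have h2 := abs_nonneg (N i - K / R)
      nlinarith
  refine (Finset.abs_sum_le_sum_abs _ _).trans ((Finset.sum_le_sum hpt).trans ?_)
  rw [Finset.sum_add_distrib, Finset.sum_sub_distrib, Finset.sum_sub_distrib, hNsum,
    ← Finset.sum_filter, Finset.sum_const, Finset.sum_const, Finset.sum_const, Finset.card_range]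
  have hfb : (Finset.range R).filter (fun i => i ∈ bad) = bad := by
    ext x; simp only [Finset.mem_filter]; exact ⟨fun h => h.2, fun h => ⟨hbad h, h⟩⟩
  rw [hfb]
  simp only [nsmul_eq_mul]
  apply le_of_eq
  field_simp
  ring

lemma block_compare (S : Finset ℕ) (hE : Even S.card) (L : ℕ) (hL : ∀ l ∈ S, l ≤ L)
    (l d q K : ℕ) (hq : 0 < q) (X α : ℝ) (hX : 0 ≤ X) (hα : 0 ≤ α) (a : ℤ)
    (hco : IsCoprime (q:ℤ) a) (ha : |q * (α / (2 ^ l : ℕ)) - a| ≤ 1 / q) (φ : ℕ → ℝ)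
    (hφ1 : ∀ k < K + L, X + k * α ≤ φ k)
    (hφ2 : ∀ k < K + L, (2:ℝ) ^ d * φ k ≤ 2 ^ d * (X + k * α) + 1) :
    |∑ k ∈ Finset.range K, tmProd S (fun x => ⌊φ (k + x)⌋₊)
      - (K:ℝ) / (2 ^ l * 2 ^ d) * tmJ S d l ⌊(2:ℝ) ^ d * α⌋₊|
      ≤ 4 * (2 ^ l * 2 ^ d) * K / q + 2 * q + 4 * (2 ^ l * 2 ^ d)
        + 2 * (S.card * (L + 1) * 2 ^ l + L * ⌊(2:ℝ) ^ d * α⌋₊) * (K / (2 ^ l * 2 ^ d)) := by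
  set P := 2 ^ l with hP
  set D := 2 ^ d with hD
  have hPpos : 0 < P := by positivity
  have hDpos : 0 < D := by positivity
  have hDc : ((2:ℝ)) ^ d = (D:ℝ) := by rw [hD]; push_cast; rfl
  have hPc : ((2:ℝ)) ^ l = (P:ℝ) := by rw [hP]; push_cast; rfl
  rw [hDc] at hφ2
  rw [hDc, hPc]
  have hPr : (0:ℝ) < P := by exact_mod_cast hPpos
  have hDr : (0:ℝ) < D := by exact_mod_cast hDpos
  have hqr : (0:ℝ) < q := by exact_mod_cast hq
  set j := ⌊(D:ℝ) * α⌋₊ with hj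
  set bad := (Finset.range (P * D)).filter
      (fun i => (∃ x ∈ S, (i + x * j) % D ∈ topRes D (L + 2)) ∨ P * D ≤ i + L * j) with hbad
  have hbc : (bad.card : ℝ) ≤ S.card * (L + 1) * P + L * j := by
    have h1 : bad.card ≤ S.card * (P * (L + 1)) + L * j := by
      rw [hbad, Finset.filter_or]
      refine (Finset.card_union_le _ _).trans ?_
      refine Nat.add_le_add ?_ ?_
      · refine (card_residue_union S P D j hDpos _).trans ?_
        have := card_topRes D (L + 2)
        gcongr
        simpa using this
      · have : (Finset.range (P * D)).filter (fun i => P * D ≤ i + L * j)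
            ⊆ Finset.Ico (P * D - L * j) (P * D) := by
          intro x hx
          simp only [Finset.mem_filter, Finset.mem_range, Finset.mem_Ico] at *
          omega
        refine (Finset.card_le_card this).trans ?_
        rw [Nat.card_Ico]; omega
    have h2 : (bad.card : ℝ) ≤ S.card * (P * (L + 1)) + L * j := by exact_mod_cast h1
    linarith
  have hgood : ∀ k < K, cell P D X α k ∉ bad →
      tmProd S (fun x => ⌊φ (k + x)⌋₊) = tmProd S (fun x => (cell P D X α k + x * j) / D) := by
    intro k hk hnb
    set i := cell P D X α k with hi
    have hiR : i < P * D := Nat.mod_lt _ (by positivity)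
    simp only [hbad, Finset.mem_filter, Finset.mem_range, not_and, not_or, not_exists] at hnb
    obtain ⟨hnb1, hnb2⟩ := hnb hiR
    push Not at hnb2
    set u := ⌊(D:ℝ) * (X + k * α)⌋₊ with hu
    set w := u / (P * D) with hw
    have hui : u = i + P * D * w := (Nat.mod_add_div u (P * D)).symm
    have hfl : ∀ x ∈ S, ⌊φ (k + x)⌋₊ = (i + x * j) / D + P * w := by
      intro x hx
      have hxL := hL x hx
      have hres := hnb1 x hx
      have hlt := Nat.mod_lt (i + x * j) hDpos
      simp only [topRes, Finset.mem_filter, Finset.mem_range, not_and, not_lt] at hres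
      have hres' := hres hlt
      have hdm := Nat.mod_add_div (i + x * j) D
      set y := (i + x * j) / D with hy
      set rr := (i + x * j) % D with hrr
      have hnn : 0 ≤ (D:ℝ) * (X + k * α) := by positivity
      have h1 := Nat.floor_le hnn
      have h2 := Nat.lt_floor_add_one ((D:ℝ) * (X + k * α))
      rw [← hu] at h1 h2
      have h3 := Nat.floor_le (show 0 ≤ (D:ℝ) * α by positivity)
      have h4 := Nat.lt_floor_add_one ((D:ℝ) * α)
      rw [← hj] at h3 h4
      have h5 := hφ1 (k + x) (by omega)
      have h6 := hφ2 (k + x) (by omega)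
      have huR : (u:ℝ) + x * j = rr + D * (y + P * w) := by
        have : u + x * j = rr + D * (y + P * w) := by
          rw [hui, mul_add, ← mul_assoc D P w, mul_comm D P]; omega
        exact_mod_cast this
      have hxr : (0:ℝ) ≤ x := Nat.cast_nonneg _
      have hxj : (x:ℝ) * j ≤ x * (D * α) := mul_le_mul_of_nonneg_left h3 hxr
      have hxj2 : (x:ℝ) * (D * α) ≤ x * (j + 1) := mul_le_mul_of_nonneg_left h4.le hxr
      have hxLr : (x:ℝ) ≤ L := by exact_mod_cast hxL
      have hresr : (rr:ℝ) + (L + 2) ≤ D := by exact_mod_cast hres'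
      have hrr0 : (0:ℝ) ≤ rr := Nat.cast_nonneg _
      push_cast at h5 h6
      have h7 : (D:ℝ) * (y + P * w) ≤ D * φ (k + x) := by
        have := mul_le_mul_of_nonneg_left h5 hDr.le
        nlinarith
      have h8 : (D:ℝ) * φ (k + x) < D * (y + P * w + 1) := by nlinarith
      have h9 : ((y:ℝ) + P * w) ≤ φ (k + x) := le_of_mul_le_mul_left h7 hDr
      have h10 : φ (k + x) < y + P * w + 1 := lt_of_mul_lt_mul_left h8 hDr.le
      rw [Nat.floor_eq_iff (le_trans (by positivity) h9)]
      push_cast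
      exact ⟨h9, h10⟩
    rw [tmProd_congr S _ _ hfl]
    unfold tmProd
    rw [Finset.prod_congr rfl (g := fun x => tm ((i + x * j) / D) * tm w)]
    · rw [Finset.prod_mul_distrib, Finset.prod_const]
      obtain ⟨e, he⟩ := hE
      rw [he, pow_add, ← mul_pow, tm_mul_self]; simp
    · intro x hx
      rw [hP]
      refine tm_add_mul l _ _ ?_
      have hxL := hL x hx
      have : x * j ≤ L * j := Nat.mul_le_mul_right _ hxL
      refine Nat.div_lt_of_lt_mul ?_
      have h0 : D * 2 ^ l = P * D := by rw [hP, mul_comm]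
      omega
  set U : ℝ := ((K:ℝ) / q + 1) * (q / (P * D) + 2) with hU
  have hUe : P * D * U = K + 2 * (P * D) * K / q + q + 2 * (P * D) := by
    rw [hU]; field_simp; ring
  have hUK : (K:ℝ) / ((P * D : ℕ):ℝ) ≤ U := by
    rw [div_le_iff₀ (by positivity)]
    push_cast
    have : 0 ≤ 2 * ((P:ℝ) * D) * K / q := by positivity
    nlinarith
  have hmain := cell_compare (P * D) K (by positivity) (cell P D X α)
    (fun k => Nat.mod_lt _ (by positivity)) (fun k => tmProd S (fun x => ⌊φ (k + x)⌋₊))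
    (fun i => tmProd S (fun x => (i + x * j) / D)) (fun k => (abs_tmProd _ _).le)
    (fun k => (abs_tmProd _ _).le) bad hgood (Finset.filter_subset _ _) U
    (fun i => block_count P D q K hPpos hDpos hq X α hX hα a hco ha i) hUK
  have hJ : tmJ S d l j = ∑ i ∈ Finset.range (P * D), tmProd S (fun x => (i + x * j) / D) := rfl
  rw [hJ]
  push_cast at hmain
  refine hmain.trans ?_
  rw [hUe]
  have hk : (0:ℝ) ≤ K / (P * D) := by positivity
  have h1 : 2 * (bad.card:ℝ) * (K / (P * D)) ≤ 2 * (S.card * (L + 1) * P + L * j) * (K / (P * D)) := by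
    gcongr
  have h2 : 2 * (K + 2 * ((P:ℝ) * D) * K / q + q + 2 * (P * D) - K)
    = 4 * (P * D) * K / q + 2 * q + 4 * (P * D) := by ring
  linarith


/-- Slopes close to a rational with small denominator. -/
def isBad (θ : ℝ) (Q Q0 : ℕ) : Prop :=
  ∃ r : ℚ, |θ - r| ≤ 1 / ((Q + 1) * r.den) ∧ r.den < Q0

open Classical in
lemma bad_count (α : ℕ → ℝ) (M H : ℕ) (P sep : ℝ) (Q Q0 : ℕ) (hQ1 : 1 ≤ Q) (hP : 0 < P)
    (hsep : 0 < sep)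
    (hα : ∀ n < H, 0 ≤ α (M + n) ∧ α (M + n) ≤ P)
    (hs : ∀ n n', n ≤ n' → n' < H → sep * ((n':ℝ) - n) ≤ α (M + n') - α (M + n)) :
    (((Finset.range H).filter (fun n => isBad (α (M + n) / P) Q Q0)).card : ℝ)
      ≤ Q0 * (4 * P / ((Q + 1) * sep) + Q0) := by
  set E : ℕ → ℕ → Finset ℕ := fun q a => (Finset.range H).filter
    (fun n => |α (M + n) / P - a / q| ≤ 1 / ((Q + 1) * q)) with hE
  have hQ : (0:ℝ) < Q + 1 := by positivity
  have hsub : (Finset.range H).filter (fun n => isBad (α (M + n) / P) Q Q0)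
      ⊆ (Finset.Ico 1 Q0).biUnion (fun q => (Finset.range (q + 1)).biUnion (fun a => E q a)) := by
    intro n hn
    rw [Finset.mem_filter, Finset.mem_range] at hn
    simp only [Finset.mem_filter, Finset.mem_range, Finset.mem_biUnion, Finset.mem_Ico, hE]
    obtain ⟨hnH, r, hr, hrd⟩ := hn
    have hd : (0:ℝ) < r.den := by exact_mod_cast r.den_pos
    have hrr : (r:ℝ) = r.num / r.den := by exact_mod_cast (Rat.num_div_den r).symm
    obtain ⟨h0, h1⟩ := hα n hnH
    have hθ0 : 0 ≤ α (M + n) / P := by positivity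
    have hθ1 : α (M + n) / P ≤ 1 := by rw [div_le_one hP]; exact h1
    have hsm : |r.den * (α (M + n) / P) - r.num| ≤ 1 / (Q + 1) := by
      have e : r.den * (α (M + n) / P) - r.num = r.den * (α (M + n) / P - r) := by
        rw [hrr]; field_simp
      rw [e, abs_mul, abs_of_pos hd]
      calc _ ≤ (r.den:ℝ) * (1 / ((Q + 1) * r.den)) := by gcongr
        _ = _ := by field_simp
    have hQ1' : (1:ℝ) / (Q + 1) < 1 := by
      have : (1:ℝ) ≤ Q := by exact_mod_cast hQ1
      rw [div_lt_one hQ]; linarith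
    rw [abs_le] at hsm
    have hn0 : -1 < r.num := by
      have : (-1:ℝ) < r.num := by nlinarith
      exact_mod_cast this
    have hn1 : r.num < r.den + 1 := by
      have : (r.num:ℝ) < r.den + 1 := by nlinarith
      exact_mod_cast this
    refine ⟨r.den, ⟨r.den_pos, hrd⟩, r.num.toNat, by omega, hnH, ?_⟩
    have e : ((r.num.toNat : ℕ) : ℝ) = r.num := by
      have : ((r.num.toNat : ℕ) : ℤ) = r.num := Int.toNat_of_nonneg (by omega)
      exact_mod_cast this
    rw [e, ← hrr]; exact hr
  have hEc : ∀ q, 1 ≤ q → ∀ a, ((E q a).card : ℝ) ≤ 2 * P / ((Q + 1) * q * sep) + 1 := by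
    intro q hq a
    have hqr : (0:ℝ) < q := by exact_mod_cast hq
    refine nat_card_le _ _ (by positivity) ?_
    have key : ∀ n ∈ E q a, ∀ n' ∈ E q a, n' ≤ n → (n:ℝ) - n' ≤ 2 * P / ((Q + 1) * q * sep) := by
      intro n hn n' hn' hle
      simp only [hE, Finset.mem_filter, Finset.mem_range] at hn hn'
      have h1 := hs n' n hle hn.1
      have h2 := (abs_le.mp hn.2).2
      have h3 := (abs_le.mp hn'.2).1
      have h4 : (α (M + n) - α (M + n')) / P ≤ 2 * (1 / ((Q + 1) * q)) := by
        rw [sub_div]; linarith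
      rw [div_le_iff₀ hP] at h4
      rw [le_div_iff₀ (by positivity)]
      have h5 : ((n:ℝ) - n') * sep ≤ 2 * (1 / ((Q + 1) * q)) * P := by linarith
      calc ((n:ℝ) - n') * ((Q + 1) * q * sep) = ((n:ℝ) - n') * sep * ((Q + 1) * q) := by ring
        _ ≤ 2 * (1 / ((Q + 1) * q)) * P * ((Q + 1) * q) := by gcongr
        _ = 2 * P := by field_simp
    intro n hn n' hn'
    rcases le_total n' n with h | h
    · exact key n hn n' hn' h
    · have : (n:ℝ) ≤ n' := by exact_mod_cast h
      have : (0:ℝ) ≤ 2 * P / ((Q + 1) * q * sep) := by positivity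
      linarith
  have h1 := (Finset.card_le_card hsub).trans Finset.card_biUnion_le
  have h2 : (((Finset.range H).filter (fun n => isBad (α (M + n) / P) Q Q0)).card : ℝ)
      ≤ ∑ q ∈ Finset.Ico 1 Q0, (4 * P / ((Q + 1) * sep) + Q0) := by
    calc _ ≤ ((∑ q ∈ Finset.Ico 1 Q0, ((Finset.range (q + 1)).biUnion (fun a => E q a)).card : ℕ) : ℝ) := by
          exact_mod_cast h1
      _ ≤ _ := by
        push_cast
        refine Finset.sum_le_sum (fun q hq => ?_)
        rw [Finset.mem_Ico] at hq
        have hqr : (1:ℝ) ≤ q := by exact_mod_cast hq.1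
        have hq0 : (q:ℝ) + 1 ≤ Q0 := by exact_mod_cast hq.2
        calc (((Finset.range (q + 1)).biUnion (fun a => E q a)).card : ℝ)
            ≤ ((∑ a ∈ Finset.range (q + 1), (E q a).card : ℕ) : ℝ) := by
              exact_mod_cast Finset.card_biUnion_le
          _ ≤ ∑ a ∈ Finset.range (q + 1), (2 * P / ((Q + 1) * q * sep) + 1) := by
              push_cast
              exact Finset.sum_le_sum (fun a _ => hEc q hq.1 a)
          _ = (q + 1) * (2 * P / ((Q + 1) * q * sep)) + (q + 1) := by
              rw [Finset.sum_const, Finset.card_range, nsmul_eq_mul]; push_cast; ring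
          _ ≤ (2 * q) * (2 * P / ((Q + 1) * q * sep)) + Q0 := by
              gcongr
              linarith
          _ = 4 * P / ((Q + 1) * sep) + Q0 := by field_simp; ring
  refine h2.trans ?_
  rw [Finset.sum_const, Nat.card_Ico, nsmul_eq_mul]
  have : ((Q0 - 1 : ℕ) : ℝ) ≤ Q0 := by exact_mod_cast Nat.sub_le _ _
  gcongr

open Classical in
lemma stepA (S : Finset ℕ) (hE : Even S.card) (L : ℕ) (hL : ∀ l ∈ S, l ≤ L)
    (f α : ℕ → ℝ) (M H K l d Q Q0 : ℕ) (B G bd : ℝ) (hB : 1 ≤ B) (hG : 0 < G) (hK : 0 < K)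
    (hQ1 : 1 ≤ Q) (hQK : Q * B ≤ K) (hQ0 : 2 ^ l * 2 ^ d * B ≤ Q0)
    (hf : ∀ n < H, 0 ≤ f (M + n))
    (hα : ∀ n < H, 0 ≤ α (M + n) ∧ α (M + n) ≤ 2 ^ l / G)
    (hφ1 : ∀ n < H, ∀ k < K + L, f (M + n) + k * α (M + n) ≤ f (M + n + k))
    (hφ2 : ∀ n < H, ∀ k < K + L, (2:ℝ) ^ d * f (M + n + k)
      ≤ 2 ^ d * (f (M + n) + k * α (M + n)) + 1)
    (hbd : (((Finset.range H).filter (fun n => isBad (α (M + n) / (2 ^ l)) Q Q0)).card : ℝ) ≤ bd) :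
    |∑ n ∈ Finset.range H, tmProd S (fun x => ⌊f (M + n + x)⌋₊)
      - ∑ n ∈ Finset.range H, 1 / (2 ^ l * 2 ^ d) * tmJ S d l ⌊(2:ℝ) ^ d * α (M + n)⌋₊|
      ≤ 2 * K + H * (10 / B + 2 * S.card * (L + 1) / 2 ^ d + 2 * L / G) + 2 * bd := by
  set R : ℝ := 2 ^ l * 2 ^ d with hR
  have hRpos : 0 < R := by positivity
  have hKr : (0:ℝ) < K := by exact_mod_cast hK
  set η : ℝ := 10 / B + 2 * S.card * (L + 1) / 2 ^ d + 2 * L / G with hη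
  have hη0 : 0 ≤ η := by positivity
  set A : ℕ → ℝ := fun n => tmProd S (fun x => ⌊f (M + n + x)⌋₊) with hA
  set J : ℕ → ℝ := fun n => 1 / R * tmJ S d l ⌊(2:ℝ) ^ d * α (M + n)⌋₊ with hJ
  have hJ1 : ∀ n, |J n| ≤ 1 := by
    intro n
    simp only [hJ]
    rw [abs_mul, abs_of_pos (by positivity)]
    have := abs_tmJ_le S d l ⌊(2:ℝ) ^ d * α (M + n)⌋₊
    calc _ ≤ 1 / R * R := by gcongr
      _ = 1 := by field_simp
  have hA1 : ∀ n, |A n| ≤ 1 := fun n => (abs_tmProd _ _).le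
  have hpt : ∀ n ∈ Finset.range H, |∑ k ∈ Finset.range K, A (n + k) - K * J n|
      ≤ K * η + (if isBad (α (M + n) / (2 ^ l)) Q Q0 then 2 * (K:ℝ) else 0) := by
    intro n hn
    rw [Finset.mem_range] at hn
    split_ifs with hb
    · have h1 : |∑ k ∈ Finset.range K, A (n + k)| ≤ K := by
        refine (Finset.abs_sum_le_sum_abs _ _).trans ((Finset.sum_le_sum (fun k _ => hA1 _)).trans ?_)
        simp
      have h2 : |K * J n| ≤ K := by
        rw [abs_mul, abs_of_pos hKr]; nlinarith [hJ1 n]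
      have h3 := abs_sub (∑ k ∈ Finset.range K, A (n + k)) (K * J n)
      have : 0 ≤ K * η := by positivity
      linarith
    · obtain ⟨r, hr1, hr2⟩ := Real.exists_rat_abs_sub_le_and_den_le (α (M + n) / 2 ^ l)
        (n := Q) (by omega)
      have hq0 : Q0 ≤ r.den := by
        by_contra hlt
        exact hb ⟨r, hr1, by omega⟩
      have hd : (0:ℝ) < r.den := by exact_mod_cast r.den_pos
      have hrr : (r:ℝ) = r.num / r.den := by exact_mod_cast (Rat.num_div_den r).symm
      have hqQ : (r.den:ℝ) ≤ Q := by exact_mod_cast hr2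
      have hq0r : (Q0:ℝ) ≤ r.den := by exact_mod_cast hq0
      have hsm : |r.den * (α (M + n) / (2 ^ l : ℕ)) - r.num| ≤ 1 / r.den := by
        push_cast
        have e : r.den * (α (M + n) / 2 ^ l) - r.num = r.den * (α (M + n) / 2 ^ l - r) := by
          rw [hrr]; field_simp
        rw [e, abs_mul, abs_of_pos hd]
        calc _ ≤ (r.den:ℝ) * (1 / ((Q + 1) * r.den)) := by gcongr
          _ = 1 / (Q + 1) := by field_simp
          _ ≤ _ := by gcongr; linarith
      have hco : IsCoprime (r.den:ℤ) r.num := by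
        rw [Int.isCoprime_iff_gcd_eq_one]
        have := r.reduced
        rw [Int.gcd_comm]
        simpa [Int.gcd, Nat.Coprime] using this
      obtain ⟨hα0, hα1⟩ := hα n hn
      have hmain := block_compare S hE L hL l d r.den K r.den_pos (f (M + n)) (α (M + n)) (hf n hn)
        hα0 r.num hco hsm (fun k => f (M + n + k)) (hφ1 n hn) (hφ2 n hn)
      have e1 : ∑ k ∈ Finset.range K, A (n + k)
          = ∑ k ∈ Finset.range K, tmProd S (fun x => ⌊f (M + n + (k + x))⌋₊) := by
        refine Finset.sum_congr rfl (fun k _ => ?_)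
        simp only [hA]
        refine tmProd_congr _ _ _ (fun x _ => ?_)
        rw [show M + (n + k) + x = M + n + (k + x) by ring]
      have e2 : (K:ℝ) * J n = (K:ℝ) / R * tmJ S d l ⌊(2:ℝ) ^ d * α (M + n)⌋₊ := by
        simp only [hJ]; ring
      rw [e1, e2, add_zero]
      refine hmain.trans ?_
      rw [← hR]
      have hBpos : 0 < B := by linarith
      have hRq : R * B ≤ r.den := hQ0.trans hq0r
      have t1 : 4 * R * K / r.den ≤ K * (4 / B) := by
        rw [div_le_iff₀ hd]
        calc 4 * R * K = K * (4 / B) * (R * B) := by field_simp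
          _ ≤ _ := by gcongr
      have hqK : (r.den:ℝ) * B ≤ K := le_trans (by gcongr) hQK
      have t2 : 2 * (r.den:ℝ) ≤ K * (2 / B) := by
        calc 2 * (r.den:ℝ) = r.den * B * (2 / B) := by field_simp
          _ ≤ _ := by gcongr
      have t3 : 4 * R ≤ K * (4 / B) := by
        have : R ≤ r.den := by nlinarith
        calc 4 * R ≤ 4 * r.den := by linarith
          _ = r.den * B * (4 / B) := by field_simp
          _ ≤ _ := by gcongr
      have hj : (⌊(2:ℝ) ^ d * α (M + n)⌋₊ : ℝ) ≤ 2 ^ d * (2 ^ l / G) := by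
        refine (Nat.floor_le (by positivity)).trans ?_
        gcongr
      have t4 : 2 * (S.card * (L + 1) * 2 ^ l + L * (⌊(2:ℝ) ^ d * α (M + n)⌋₊ : ℝ)) * (K / R)
          ≤ K * (2 * S.card * (L + 1) / 2 ^ d + 2 * L / G) := by
        calc _ ≤ 2 * (S.card * (L + 1) * 2 ^ l + L * (2 ^ d * (2 ^ l / G))) * (K / R) := by gcongr
          _ = _ := by rw [hR]; field_simp
      have : K * η = K * (4 / B) + K * (2 / B) + K * (4 / B)
          + K * (2 * S.card * (L + 1) / 2 ^ d + 2 * L / G) := by rw [hη]; ring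
      linarith
  have hs1 : |∑ n ∈ Finset.range H, (∑ k ∈ Finset.range K, A (n + k) - K * J n)|
      ≤ H * (K * η) + 2 * K * bd := by
    refine (Finset.abs_sum_le_sum_abs _ _).trans ((Finset.sum_le_sum hpt).trans ?_)
    rw [Finset.sum_add_distrib, ← Finset.sum_filter, Finset.sum_const, Finset.sum_const,
      Finset.card_range, nsmul_eq_mul, nsmul_eq_mul]
    nlinarith
  have hs2 : |∑ k ∈ Finset.range K, (∑ n ∈ Finset.range H, A (n + k) - ∑ n ∈ Finset.range H, A n)|
      ≤ K * (2 * K) := by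
    have : ∀ k ∈ Finset.range K,
        |∑ n ∈ Finset.range H, A (n + k) - ∑ n ∈ Finset.range H, A n| ≤ 2 * K := by
      intro k hk
      rw [Finset.mem_range] at hk
      have h1 := sum_shift A 1 hA1 H k
      have h2 : (k:ℝ) ≤ K := by exact_mod_cast hk.le
      linarith
    refine (Finset.abs_sum_le_sum_abs _ _).trans ((Finset.sum_le_sum this).trans ?_)
    simp
  rw [Finset.sum_sub_distrib, Finset.sum_comm, ← Finset.mul_sum] at hs1
  rw [Finset.sum_sub_distrib, Finset.sum_const, Finset.card_range, nsmul_eq_mul] at hs2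
  have hfin : |(K:ℝ) * (∑ n ∈ Finset.range H, A n - ∑ n ∈ Finset.range H, J n)|
      ≤ K * (2 * K + H * η + 2 * bd) := by
    rw [abs_le] at *
    constructor <;> nlinarith [hs1.1, hs1.2, hs2.1, hs2.2]
  rw [abs_mul, abs_of_pos hKr] at hfin
  exact le_of_mul_le_mul_left hfin hKr

lemma stepB (S : Finset ℕ) (L : ℕ) (hL : ∀ l ∈ S, l ≤ L)
    (α : ℕ → ℝ) (M H l d V wmax : ℕ) (w : ℕ → ℕ) (γ : ℝ) (hV : 0 < V)
    (hw : ∀ s < V, w s ≤ wmax)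
    (hα : ∀ n < H, 0 ≤ α (M + n))
    (hs1 : ∀ n < H, ∀ s < V, (2:ℝ) ^ d * α (M + n) + s - 1 ≤ 2 ^ d * α (M + n + w s))
    (hs2 : ∀ n < H, ∀ s < V, (2:ℝ) ^ d * α (M + n + w s) ≤ 2 ^ d * α (M + n) + s)
    (hwin : ∀ j, |∑ s ∈ Finset.range V, tmJ S d l (j + s)| ≤ γ * V * (2 ^ l * 2 ^ d)) :
    |∑ n ∈ Finset.range H, 1 / (2 ^ l * 2 ^ d) * tmJ S d l ⌊(2:ℝ) ^ d * α (M + n)⌋₊|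
      ≤ 2 * wmax + H * (2 * S.card * L / 2 ^ d + γ) := by
  set R : ℝ := 2 ^ l * 2 ^ d with hR
  have hRpos : 0 < R := by positivity
  have hVr : (0:ℝ) < V := by exact_mod_cast hV
  set J : ℕ → ℝ := fun j => 1 / R * tmJ S d l j with hJ
  set j : ℕ → ℕ := fun n => ⌊(2:ℝ) ^ d * α (M + n)⌋₊ with hj
  have hJ1 : ∀ n, |J n| ≤ 1 := by
    intro n
    simp only [hJ]
    rw [abs_mul, abs_of_pos (by positivity)]
    have := abs_tmJ_le S d l n
    calc _ ≤ 1 / R * R := by gcongr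
      _ = 1 := by field_simp
  have hlip : ∀ n, |J (n + 1) - J n| ≤ 2 * S.card * L / 2 ^ d := by
    intro n
    simp only [hJ]
    rw [← mul_sub, abs_mul, abs_of_pos (by positivity)]
    have := tmJ_lip S L hL d l n
    calc _ ≤ 1 / R * (2 * (S.card * L * 2 ^ l)) := by gcongr
      _ = _ := by rw [hR]; field_simp
  have hclose : ∀ n < H, ∀ s < V, |J (j (n + w s)) - J (j n + s)| ≤ 2 * S.card * L / 2 ^ d := by
    intro n hn s hs
    have h0 : 0 ≤ (2:ℝ) ^ d * α (M + n) := mul_nonneg (by positivity) (hα n hn)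
    have h1 := hs1 n hn s hs
    have h2 := hs2 n hn s hs
    have hup : j (n + w s) ≤ j n + s := by
      simp only [hj]
      rw [← Nat.floor_add_natCast h0, ← add_assoc]
      exact Nat.floor_le_floor h2
    have hlo : j n + s ≤ j (n + w s) + 1 := by
      simp only [hj]
      rw [← Nat.floor_add_natCast h0, ← add_assoc]
      by_cases hneg : 0 ≤ (2:ℝ) ^ d * α (M + n + w s)
      · rw [← Nat.floor_add_one hneg]
        exact Nat.floor_le_floor (by linarith)
      · push Not at hneg
        have : ⌊(2:ℝ) ^ d * α (M + n) + s⌋₊ = 0 := by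
          rw [Nat.floor_eq_zero]; linarith
        omega
    have hcase : j n + s = j (n + w s) ∨ j n + s = j (n + w s) + 1 := by omega
    rcases hcase with h | h
    · rw [h]; simp; positivity
    · rw [h, abs_sub_comm]; exact hlip _
  have hwin' : ∀ n, |∑ s ∈ Finset.range V, J (n + s)| ≤ V * γ := by
    intro n
    simp only [hJ]
    rw [← Finset.mul_sum, abs_mul, abs_of_pos (by positivity)]
    calc _ ≤ 1 / R * (γ * V * R) := by gcongr; exact hwin n
      _ = _ := by field_simp
  set ζ : ℝ := 2 * S.card * L / 2 ^ d with hζ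
  have hb1 : |∑ n ∈ Finset.range H, ∑ s ∈ Finset.range V, J (j (n + w s))| ≤ H * (V * ζ + V * γ) := by
    have : ∀ n ∈ Finset.range H, |∑ s ∈ Finset.range V, J (j (n + w s))| ≤ V * ζ + V * γ := by
      intro n hn
      rw [Finset.mem_range] at hn
      have h1 : |∑ s ∈ Finset.range V, (J (j (n + w s)) - J (j n + s))| ≤ V * ζ := by
        refine (Finset.abs_sum_le_sum_abs _ _).trans ((Finset.sum_le_sum
          (fun s hs => hclose n hn s (Finset.mem_range.mp hs))).trans ?_)
        simp
      have h2 := hwin' (j n)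
      rw [Finset.sum_sub_distrib] at h1
      rw [abs_le] at *
      constructor <;> linarith [h1.1, h1.2, h2.1, h2.2]
    refine (Finset.abs_sum_le_sum_abs _ _).trans ((Finset.sum_le_sum this).trans ?_)
    rw [Finset.sum_const, Finset.card_range, nsmul_eq_mul]
  have hb2 : |∑ s ∈ Finset.range V, (∑ n ∈ Finset.range H, J (j (n + w s)) - ∑ n ∈ Finset.range H, J (j n))|
      ≤ V * (2 * wmax) := by
    have : ∀ s ∈ Finset.range V,
        |∑ n ∈ Finset.range H, J (j (n + w s)) - ∑ n ∈ Finset.range H, J (j n)| ≤ 2 * wmax := by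
      intro s hs
      rw [Finset.mem_range] at hs
      have h1 := sum_shift (fun n => J (j n)) 1 (fun n => hJ1 _) H (w s)
      have h2 : (w s:ℝ) ≤ wmax := by exact_mod_cast hw s hs
      linarith
    refine (Finset.abs_sum_le_sum_abs _ _).trans ((Finset.sum_le_sum this).trans ?_)
    simp
  rw [Finset.sum_comm] at hb1
  rw [Finset.sum_sub_distrib, Finset.sum_const, Finset.card_range, nsmul_eq_mul] at hb2
  have hfin : |(V:ℝ) * ∑ n ∈ Finset.range H, J (j n)| ≤ V * (2 * wmax + H * (ζ + γ)) := by
    rw [abs_le] at *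
    constructor <;> nlinarith [hb1.1, hb1.2, hb2.1, hb2.2]
  rw [abs_mul, abs_of_pos hVr] at hfin
  exact le_of_mul_le_mul_left hfin hVr


open Filter in
lemma walk (a : ℕ → ℝ) (ha : ∀ n, |a n| ≤ 1)
    (h : ∀ η : ℝ, 0 < η → ∃ M0 : ℕ, ∀ M ≥ M0, ∃ H : ℕ, 1 ≤ H ∧ (H:ℝ) ≤ η * M ∧
      |∑ n ∈ Finset.range H, a (M + n)| ≤ η * H) :
    Tendsto (fun N : ℕ => (∑ n ∈ Finset.range N, a n) / N) atTop (nhds 0) := by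
  rw [Metric.tendsto_atTop]
  intro ε hε
  set η := ε / 4 with hη
  have hηpos : 0 < η := by positivity
  obtain ⟨M0, hM0⟩ := h η hηpos
  have inv : ∀ N ≥ M0, ∃ M H : ℕ, M ≤ N ∧ N < M + H ∧ (H:ℝ) ≤ η * M ∧
      |∑ n ∈ Finset.range H, a (M + n)| ≤ η * H ∧ |∑ n ∈ Finset.range M, a n| ≤ M0 + η * M := by
    intro N hN
    induction N, hN using Nat.le_induction with
    | base =>
      obtain ⟨H, h1, h2, h3⟩ := hM0 M0 le_rfl
      refine ⟨M0, H, le_rfl, by omega, h2, h3, ?_⟩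
      have h4 : |∑ n ∈ Finset.range M0, a n| ≤ M0 := by
        refine (Finset.abs_sum_le_sum_abs _ _).trans ((Finset.sum_le_sum (fun k _ => ha k)).trans ?_)
        simp
      have : 0 ≤ η * M0 := by positivity
      linarith
    | succ N hN ih =>
      obtain ⟨M, H, h1, h2, h3, h4, h5⟩ := ih
      by_cases hc : N + 1 < M + H
      · exact ⟨M, H, by omega, hc, h3, h4, h5⟩
      · have hMH : N + 1 = M + H := by omega
        obtain ⟨H', g1, g2, g3⟩ := hM0 (N + 1) (by omega)
        refine ⟨N + 1, H', le_rfl, by omega, g2, g3, ?_⟩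
        rw [hMH, Finset.sum_range_add]
        refine (abs_add_le _ _).trans ?_
        push_cast
        linarith
  obtain ⟨N1, hN1⟩ := exists_nat_gt (M0 / η)
  refine ⟨max M0 (N1 + 1), fun N hN => ?_⟩
  have hNM : M0 ≤ N := (le_max_left _ _).trans hN
  have hNN : N1 + 1 ≤ N := (le_max_right _ _).trans hN
  have hNpos : (0:ℝ) < N := by exact_mod_cast (by omega : 0 < N)
  obtain ⟨M, H, h1, h2, h3, h4, h5⟩ := inv N hNM
  obtain ⟨e, rfl⟩ := Nat.exists_eq_add_of_le h1
  have hsum : |∑ n ∈ Finset.range (M + e), a n| ≤ M0 + η * M + e := by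
    rw [Finset.sum_range_add]
    refine (abs_add_le _ _).trans ?_
    have : |∑ n ∈ Finset.range e, a (M + n)| ≤ e := by
      refine (Finset.abs_sum_le_sum_abs _ _).trans ((Finset.sum_le_sum (fun k _ => ha _)).trans ?_)
      simp
    linarith
  have he : (e:ℝ) ≤ H := by exact_mod_cast (by omega : e ≤ H)
  have hMN : (M:ℝ) ≤ ((M + e : ℕ):ℝ) := by exact_mod_cast h1
  have hM0N : (M0:ℝ) ≤ η * ((M + e : ℕ):ℝ) := by
    have h6 : (N1:ℝ) ≤ ((M + e : ℕ):ℝ) := by exact_mod_cast (by omega : N1 ≤ M + e)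
    have h7 : M0 / η ≤ ((M + e : ℕ):ℝ) := by linarith
    rw [div_le_iff₀ hηpos] at h7
    linarith
  rw [Real.dist_eq, sub_zero, abs_div, abs_of_pos hNpos, div_lt_iff₀ hNpos]
  have : η * M ≤ η * ((M + e : ℕ):ℝ) := by gcongr
  have h8 : ε = 4 * η := by rw [hη]; ring
  have h9 : 0 < η * ((M + e : ℕ):ℝ) := by positivity
  rw [h8]
  linarith

open Filter in
lemma tendsto_shift (c : ℕ → ℝ) (hc : ∀ n, |c n| ≤ 1) (e : ℕ)
    (h : Tendsto (fun N : ℕ => (∑ n ∈ Finset.range N, c n) / N) atTop (nhds 0)) :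
    Tendsto (fun N : ℕ => (∑ n ∈ Finset.range N, c (n + e)) / N) atTop (nhds 0) := by
  have h2 : Tendsto (fun N : ℕ => (2 * (e:ℝ)) / N) atTop (nhds 0) :=
    tendsto_const_div_atTop_nhds_zero_nat _
  have h3 : Tendsto (fun N : ℕ => (∑ n ∈ Finset.range N, c (n + e)) / N
      - (∑ n ∈ Finset.range N, c n) / N) atTop (nhds 0) := by
    refine squeeze_zero_norm (fun N => ?_) h2
    rw [← sub_div, Real.norm_eq_abs, abs_div, Nat.abs_cast]
    have := sum_shift c 1 hc N e
    gcongr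
    linarith
  have := h3.add h
  simpa using this

open Filter in
lemma vdc (a : ℕ → ℝ) (ha : ∀ n, |a n| ≤ 1) (r0 : ℕ) (hr0 : 1 ≤ r0)
    (h : ∀ r ≥ r0, Tendsto (fun N : ℕ => (∑ n ∈ Finset.range N, a n * a (n + r)) / N)
      atTop (nhds 0)) :
    Tendsto (fun N : ℕ => (∑ n ∈ Finset.range N, a n) / N) atTop (nhds 0) := by
  have hmul : ∀ x y, |a x * a y| ≤ 1 := by
    intro x y
    rw [abs_mul]
    exact mul_le_one₀ (ha x) (abs_nonneg _) (ha y)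
  have hoff1 : ∀ i i', i < i' → Tendsto (fun N : ℕ =>
      (∑ n ∈ Finset.range N, a (n + i * r0) * a (n + i' * r0)) / N) atTop (nhds 0) := by
    intro i i' hlt
    obtain ⟨k, rfl⟩ := Nat.exists_eq_add_of_lt hlt
    have hr : (k + 1) * r0 ≥ r0 := by nlinarith
    have := tendsto_shift (fun n => a n * a (n + (k + 1) * r0)) (fun n => hmul _ _) (i * r0) (h _ hr)
    refine this.congr (fun N => ?_)
    congr 1
    refine Finset.sum_congr rfl (fun n _ => ?_)
    congr 2
    ring
  have hoff : ∀ i i', i ≠ i' → Tendsto (fun N : ℕ =>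
      (∑ n ∈ Finset.range N, a (n + i * r0) * a (n + i' * r0)) / N) atTop (nhds 0) := by
    intro i i' hne
    rcases lt_or_gt_of_ne hne with hlt | hgt
    · exact hoff1 i i' hlt
    · refine (hoff1 i' i hgt).congr (fun N => ?_)
      congr 1
      exact Finset.sum_congr rfl (fun n _ => mul_comm _ _)
  rw [Metric.tendsto_atTop]
  intro ε hε
  obtain ⟨R, hR⟩ := exists_nat_gt (max 1 (8 / ε ^ 2))
  have hR1 : (1:ℝ) < R := lt_of_le_of_lt (le_max_left _ _) hR
  have hR2 : 8 / ε ^ 2 < R := lt_of_le_of_lt (le_max_right _ _) hR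
  have hRpos : (0:ℝ) < R := by linarith
  have hT : Tendsto (fun N : ℕ => ∑ i ∈ Finset.range R, ∑ i' ∈ Finset.range R,
      if i = i' then (0:ℝ) else
        (∑ n ∈ Finset.range N, a (n + i * r0) * a (n + i' * r0)) / N) atTop (nhds 0) := by
    rw [show (0:ℝ) = ∑ i ∈ Finset.range R, ∑ i' ∈ Finset.range R, (0:ℝ) by simp]
    refine tendsto_finsetSum _ (fun i _ => tendsto_finsetSum _ (fun i' _ => ?_))
    by_cases hii : i = i'
    · simp [hii]
    · simp only [hii, if_false]
      exact hoff i i' hii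
  set C1 : ℝ := R * (2 * (R * r0)) with hC1
  have hC : Tendsto (fun N : ℕ => C1 / N) atTop (nhds 0) := tendsto_const_div_atTop_nhds_zero_nat _
  have ev1 : ∀ᶠ N : ℕ in atTop, (∑ i ∈ Finset.range R, ∑ i' ∈ Finset.range R,
      if i = i' then (0:ℝ) else
        (∑ n ∈ Finset.range N, a (n + i * r0) * a (n + i' * r0)) / N) < 1 / 2 :=
    hT.eventually_lt_const (by norm_num)
  have ev2 : ∀ᶠ N : ℕ in atTop, C1 / N < 1 / 2 := hC.eventually_lt_const (by norm_num)
  have ev3 : ∀ᶠ N : ℕ in atTop, 1 ≤ N := eventually_ge_atTop 1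
  obtain ⟨N0, hN0⟩ := eventually_atTop.mp ((ev1.and ev2).and ev3)
  refine ⟨N0, fun N hN => ?_⟩
  obtain ⟨⟨e1, e2⟩, e3⟩ := hN0 N hN
  have hNpos : (0:ℝ) < N := by exact_mod_cast e3
  set b : ℕ → ℝ := fun n => ∑ i ∈ Finset.range R, a (n + i * r0) with hb
  set Sg := ∑ n ∈ Finset.range N, a n with hSg
  have hbS : |∑ n ∈ Finset.range N, b n - R * Sg| ≤ C1 := by
    have e : ∑ n ∈ Finset.range N, b n - R * Sg
        = ∑ i ∈ Finset.range R, (∑ n ∈ Finset.range N, a (n + i * r0) - Sg) := by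
      simp only [hb]
      rw [Finset.sum_comm, Finset.sum_sub_distrib]
      simp
    rw [e]
    have : ∀ i ∈ Finset.range R, |∑ n ∈ Finset.range N, a (n + i * r0) - Sg| ≤ 2 * (R * r0) := by
      intro i hi
      have h1 := sum_shift a 1 ha N (i * r0)
      have h2 : ((i * r0 : ℕ):ℝ) ≤ R * r0 := by
        push_cast
        have : (i:ℝ) ≤ R := by exact_mod_cast (Finset.mem_range.mp hi).le
        gcongr
      linarith
    refine (Finset.abs_sum_le_sum_abs _ _).trans ((Finset.sum_le_sum this).trans ?_)
    simp [hC1]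
  have hb2 : (∑ n ∈ Finset.range N, b n ^ 2) ≤ N * (R + 1 / 2) := by
    have e : ∑ n ∈ Finset.range N, b n ^ 2 = ∑ i ∈ Finset.range R, ∑ i' ∈ Finset.range R,
        ∑ n ∈ Finset.range N, a (n + i * r0) * a (n + i' * r0) := by
      have : ∀ n ∈ Finset.range N, b n ^ 2 = ∑ i ∈ Finset.range R, ∑ i' ∈ Finset.range R,
          a (n + i * r0) * a (n + i' * r0) := by
        intro n _
        simp only [hb]
        rw [sq, Finset.sum_mul_sum]
      rw [Finset.sum_congr rfl this, Finset.sum_comm]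
      refine Finset.sum_congr rfl (fun i _ => ?_)
      rw [Finset.sum_comm]
    rw [e]
    have hle : ∀ i ∈ Finset.range R, ∀ i' ∈ Finset.range R,
        ∑ n ∈ Finset.range N, a (n + i * r0) * a (n + i' * r0)
          ≤ (if i = i' then (N:ℝ) else 0) + N * (if i = i' then (0:ℝ) else
        (∑ n ∈ Finset.range N, a (n + i * r0) * a (n + i' * r0)) / N) := by
      intro i _ i' _
      split_ifs with hii
      · rw [mul_zero, add_zero]
        refine (Finset.sum_le_sum (fun n _ => (le_abs_self _).trans (hmul _ _))).trans ?_
        simp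
      · rw [zero_add, mul_div_cancel₀ _ hNpos.ne']
    refine (Finset.sum_le_sum (fun i hi => Finset.sum_le_sum (fun i' hi' => hle i hi i' hi'))).trans ?_
    simp only [Finset.sum_add_distrib, ← Finset.mul_sum]
    have hdiag : ∑ i ∈ Finset.range R, ∑ i' ∈ Finset.range R, (if i = i' then (N:ℝ) else 0) = R * N := by
      rw [Finset.sum_congr rfl (g := fun _ => (N:ℝ))]
      · simp
      · intro i hi
        rw [Finset.sum_ite_eq, if_pos hi]
    rw [hdiag]
    nlinarith
  have hcs : (∑ n ∈ Finset.range N, b n) ^ 2 ≤ N * (N * (R + 1 / 2)) := by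
    have := sq_sum_le_card_mul_sum_sq (s := Finset.range N) (f := b)
    rw [Finset.card_range] at this
    refine this.trans ?_
    gcongr
  have hC1N : C1 ≤ N * (1 / 2) := by
    rw [div_lt_iff₀ hNpos] at e2; linarith
  have hsq : (R * Sg) ^ 2 ≤ 4 * R * N ^ 2 := by
    set X := ∑ n ∈ Finset.range N, b n
    have h1 : (X - R * Sg) ^ 2 ≤ (N * (1 / 2)) ^ 2 := by
      rw [← sq_abs]; gcongr; exact hbS.trans hC1N
    have h2 : (R * Sg) ^ 2 ≤ 2 * X ^ 2 + 2 * (X - R * Sg) ^ 2 := by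
      nlinarith [sq_nonneg (X + (X - R * Sg))]
    have h3 : (0:ℝ) < N ^ 2 := by positivity
    nlinarith
  have hfin : (Sg / N) ^ 2 < ε ^ 2 := by
    rw [div_pow, div_lt_iff₀ (by positivity)]
    have h1 : 8 < R * ε ^ 2 := by rwa [div_lt_iff₀ (by positivity)] at hR2
    have h2 : R * Sg ^ 2 ≤ 4 * N ^ 2 := by
      have : R * (R * Sg ^ 2) ≤ R * (4 * N ^ 2) := by nlinarith
      exact le_of_mul_le_mul_left this hRpos
    have h3 : (0:ℝ) < N ^ 2 := by positivity
    have h4 : R * Sg ^ 2 < R * (ε ^ 2 * N ^ 2) := by nlinarith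
    exact lt_of_mul_lt_mul_left h4 hRpos.le
  rw [Real.dist_eq, sub_zero]
  exact abs_lt_of_sq_lt_sq hfin hε.le

lemma indicator_eq (a e : ℕ) (he : e = 0 ∨ e = 1) :
    (if thueMorse a = e then (1:ℝ) else 0) = (1 + (-1) ^ e * tm a) / 2 := by
  unfold thueMorse tm
  rcases Nat.even_or_odd (binDigitSum a) with h | h
  · rw [h.neg_one_pow, Nat.even_iff.mp h]
    rcases he with rfl | rfl <;> norm_num
  · rw [h.neg_one_pow, Nat.odd_iff.mp h]
    rcases he with rfl | rfl <;> norm_num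

open Filter in
lemma normal_of_corr (u : ℕ → ℕ) (T : ℕ) (ε : ℕ → ℕ) (hε : ∀ l < T, ε l = 0 ∨ ε l = 1)
    (h : ∀ S : Finset ℕ, S.Nonempty →
      Tendsto (fun N : ℕ => (∑ n ∈ Finset.range N, tmProd S (fun x => u (n + x))) / N)
        atTop (nhds 0)) :
    Tendsto (fun N : ℕ => (((Finset.range N).filter
            (fun n => ∀ l < T, thueMorse (u (n + l)) = ε l)).card : ℝ) / N)
      atTop (nhds (1 / 2 ^ T)) := by
  have hcard : ∀ N : ℕ, (((Finset.range N).filter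
            (fun n => ∀ l < T, thueMorse (u (n + l)) = ε l)).card : ℝ)
      = ∑ S ∈ (Finset.range T).powerset, (1 / 2 ^ T * ∏ l ∈ S, (-1:ℝ) ^ ε l) *
          ∑ n ∈ Finset.range N, tmProd S (fun x => u (n + x)) := by
    intro N
    rw [Finset.card_filter]
    push_cast
    have : ∀ n ∈ Finset.range N, (if ∀ l < T, thueMorse (u (n + l)) = ε l then (1:ℝ) else 0)
        = ∑ S ∈ (Finset.range T).powerset, (1 / 2 ^ T * ∏ l ∈ S, (-1:ℝ) ^ ε l) *
          tmProd S (fun x => u (n + x)) := by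
      intro n _
      have h1 : (if ∀ l < T, thueMorse (u (n + l)) = ε l then (1:ℝ) else 0)
          = ∏ l ∈ Finset.range T, (if thueMorse (u (n + l)) = ε l then (1:ℝ) else 0) := by
        rw [Finset.prod_boole]
        simp only [Finset.mem_range]
      rw [h1, Finset.prod_congr rfl (fun l hl => indicator_eq (u (n + l)) (ε l)
        (hε l (Finset.mem_range.mp hl))), Finset.prod_div_distrib, Finset.prod_one_add]
      rw [Finset.prod_const, Finset.card_range, Finset.sum_div]
      refine Finset.sum_congr rfl (fun S _ => ?_)
      unfold tmProd
      rw [Finset.prod_mul_distrib]; ring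
    rw [Finset.sum_congr rfl this, Finset.sum_comm]
    exact Finset.sum_congr rfl (fun S _ => by rw [Finset.mul_sum])
  have hlim : Tendsto (fun N : ℕ => ∑ S ∈ (Finset.range T).powerset,
      (1 / 2 ^ T * ∏ l ∈ S, (-1:ℝ) ^ ε l) *
        ((∑ n ∈ Finset.range N, tmProd S (fun x => u (n + x))) / N)) atTop
      (nhds (∑ S ∈ (Finset.range T).powerset,
        (1 / 2 ^ T * ∏ l ∈ S, (-1:ℝ) ^ ε l) * (if S = ∅ then 1 else 0))) := by
    refine tendsto_finsetSum _ (fun S _ => ?_)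
    refine Tendsto.const_mul _ ?_
    by_cases hS : S = ∅
    · subst hS
      simp only [if_true]
      refine tendsto_const_nhds.congr' ?_
      filter_upwards [eventually_ge_atTop 1] with N hN
      have hNpos : (0:ℝ) < N := by exact_mod_cast hN
      simp only [tmProd, Finset.prod_empty, Finset.sum_const, Finset.card_range, nsmul_eq_mul, mul_one]
      rw [div_self hNpos.ne']
    · simp only [hS, if_false]
      exact h S (Finset.nonempty_iff_ne_empty.mpr hS)
  have hval : (∑ S ∈ (Finset.range T).powerset,
        (1 / 2 ^ T * ∏ l ∈ S, (-1:ℝ) ^ ε l) * (if S = ∅ then 1 else 0)) = 1 / 2 ^ T := by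
    simp
  rw [hval] at hlim
  refine hlim.congr (fun N => ?_)
  rw [hcard, Finset.sum_div]
  exact Finset.sum_congr rfl (fun S _ => by ring)

open Filter in
lemma odd_of_even (u : ℕ → ℕ)
    (h : ∀ S : Finset ℕ, S.Nonempty → Even S.card →
      Tendsto (fun N : ℕ => (∑ n ∈ Finset.range N, tmProd S (fun x => u (n + x))) / N)
        atTop (nhds 0)) (S : Finset ℕ) (hS : S.Nonempty) :
      Tendsto (fun N : ℕ => (∑ n ∈ Finset.range N, tmProd S (fun x => u (n + x))) / N)
        atTop (nhds 0) := by
  refine vdc _ (fun n => (abs_tmProd _ _).le) (S.max' hS + 1) (by omega) (fun r hr => ?_)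
  have hdis : Disjoint S (S.image (fun x => x + r)) := by
    rw [Finset.disjoint_left]
    intro x hx hx'
    rw [Finset.mem_image] at hx'
    obtain ⟨y, _, rfl⟩ := hx'
    have := S.le_max' _ hx
    omega
  have hinj : Function.Injective (fun x : ℕ => x + r) := fun x y hxy => by simpa using hxy
  have := h (S ∪ S.image (fun x => x + r)) (hS.mono Finset.subset_union_left) (by
    rw [Finset.card_union_of_disjoint hdis, Finset.card_image_of_injective _ hinj]
    exact ⟨_, rfl⟩)
  refine this.congr (fun N => ?_)
  congr 1
  refine Finset.sum_congr rfl (fun n _ => ?_)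
  unfold tmProd
  rw [Finset.prod_union hdis, Finset.prod_image (fun x _ y _ hxy => hinj hxy)]
  congr 1
  refine Finset.prod_congr rfl (fun x _ => ?_)
  show tm (u (n + (x + r))) = tm (u (n + r + x))
  rw [show n + (x + r) = n + r + x by ring]


lemma rpow_split1 (x s p : ℝ) (hx : 0 < x) (hs : 0 ≤ x + s) : (x + s) ^ p = x ^ p * (1 + s / x) ^ p := by
  rw [← Real.mul_rpow hx.le]
  · congr 1; field_simp
  · rw [show 1 + s / x = (x + s) / x by field_simp]; positivity

lemma rpow_sub_one' (x p : ℝ) (hx : 0 < x) : x ^ (p - 1) = x ^ p / x := by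
  rw [Real.rpow_sub hx, Real.rpow_one]

/-- first order lower bound for the function `x ^ c` -/
lemma pow_lower (c x k : ℝ) (hc : 1 ≤ c) (hx : 0 < x) (hk : 0 ≤ k) :
    x ^ c + k * (c * x ^ (c - 1)) ≤ (x + k) ^ c := by
  rw [rpow_split1 x k c hx (by positivity), rpow_sub_one' x c hx]
  have h := one_add_mul_self_le_rpow_one_add (s := k / x) (by have : 0 ≤ k / x := by positivity
                                                              linarith) hc
  calc _ = x ^ c * (1 + c * (k / x)) := by field_simp
    _ ≤ _ := by gcongr

lemma pow_upper (c x k : ℝ) (hc : 1 ≤ c) (hc2 : c ≤ 2) (hx : 0 < x) (hk : 0 ≤ k) :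
    (x + k) ^ c ≤ x ^ c + k * (c * x ^ (c - 1)) + k ^ 2 * (c * (c - 1) * x ^ (c - 2)) := by
  have hs : 0 ≤ k / x := by positivity
  have h := rpow_one_add_le_one_add_mul_self (s := k / x) (by linarith) (p := c - 1) (by linarith)
    (by linarith)
  have h2 : (1 + k / x) ^ c = (1 + k / x) * (1 + k / x) ^ (c - 1) := by
    rw [rpow_sub_one' _ _ (by positivity)]; field_simp
  rw [rpow_split1 x k c hx (by positivity), h2, rpow_sub_one' x c hx,
    show c - 2 = c - 1 - 1 by ring, rpow_sub_one' x (c - 1) hx, rpow_sub_one' x c hx]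
  have hxc : 0 < x ^ c := by positivity
  calc _ ≤ x ^ c * ((1 + k / x) * (1 + (c - 1) * (k / x))) := by gcongr
    _ = x ^ c * (1 + c * (k / x) + (c - 1) * (k / x) ^ 2) := by ring
    _ ≤ x ^ c * (1 + c * (k / x) + c * (c - 1) * (k / x) ^ 2) := by
      have : (c - 1) * (k / x) ^ 2 ≤ c * (c - 1) * (k / x) ^ 2 := by
        have : 0 ≤ (c - 1) * (k / x) ^ 2 := mul_nonneg (by linarith) (by positivity)
        nlinarith
      gcongr
    _ = _ := by field_simp

lemma der_upper (c x w : ℝ) (hc : 1 ≤ c) (hc2 : c ≤ 2) (hx : 0 < x) (hw : 0 ≤ w) :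
    c * (x + w) ^ (c - 1) - c * x ^ (c - 1) ≤ c * (c - 1) * x ^ (c - 2) * w := by
  have hs : 0 ≤ w / x := by positivity
  have h := rpow_one_add_le_one_add_mul_self (s := w / x) (by linarith) (p := c - 1) (by linarith)
    (by linarith)
  rw [rpow_split1 x w (c - 1) hx (by positivity),
    show c - 2 = c - 1 - 1 by ring, rpow_sub_one' x (c - 1) hx]
  have hxc : 0 < x ^ (c - 1) := by positivity
  calc _ ≤ c * (x ^ (c - 1) * (1 + (c - 1) * (w / x))) - c * x ^ (c - 1) := by gcongr
    _ = _ := by field_simp; ring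

lemma der_lower (c x w : ℝ) (hc : 1 ≤ c) (hc2 : c ≤ 2) (hx : 0 < x) (hw : 0 ≤ w) :
    c * (c - 1) * (x + w) ^ (c - 2) * w ≤ c * (x + w) ^ (c - 1) - c * x ^ (c - 1) := by
  have hy : 0 < x + w := by positivity
  have hs : w / (x + w) ≤ 1 := by rw [div_le_one hy]; linarith
  have h := rpow_one_add_le_one_add_mul_self (s := - w / (x + w))
    (by rw [neg_div]; linarith) (p := c - 1) (by linarith) (by linarith)
  have e : x ^ (c - 1) = (x + w) ^ (c - 1) * (1 + - w / (x + w)) ^ (c - 1) := by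
    rw [← rpow_split1 (x + w) (-w) (c - 1) hy (by linarith)]
    congr 1; ring
  rw [e, show c - 2 = c - 1 - 1 by ring, rpow_sub_one' (x + w) (c - 1) hy]
  have hxc : 0 < (x + w) ^ (c - 1) := by positivity
  calc _ = c * (x + w) ^ (c - 1) - c * ((x + w) ^ (c - 1) * (1 + (c - 1) * (- w / (x + w)))) := by
        field_simp; ring
    _ ≤ _ := by gcongr

lemma pow_compare (c M x e : ℝ) (hc : 1 ≤ c) (hM : 0 < M) (he : 0 ≤ e)
    (hx : M ≤ x) (hx2 : x ≤ (1 + 2 * e) * M) :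
    (1 - 2 * e) * M ^ (c - 2) ≤ x ^ (c - 2) := by
  have hxp : 0 < x := by linarith
  rw [show c - 2 = c - 1 - 1 by ring, rpow_sub_one' x (c - 1) hxp, rpow_sub_one' M (c - 1) hM]
  have h1 : M ^ (c - 1) ≤ x ^ (c - 1) := Real.rpow_le_rpow hM.le hx (by linarith)
  have h0 : 0 < M ^ (c - 1) := by positivity
  calc (1 - 2 * e) * (M ^ (c - 1) / M) ≤ M ^ (c - 1) / ((1 + 2 * e) * M) := by
        rw [mul_div_assoc', div_le_div_iff₀ hM (by positivity)]
        have : 0 ≤ M ^ (c - 1) * M * (4 * e ^ 2) := by positivity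
        nlinarith
    _ ≤ x ^ (c - 1) / x := by gcongr

set_option maxHeartbeats 2000000 in
/-- The main estimate for a single short interval, with all parameters free. -/
lemma core (c : ℝ) (hc1 : 1 < c) (hc2 : c ≤ 2) (S : Finset ℕ) (hE : Even S.card) (L : ℕ)
    (hL : ∀ l ∈ S, l ≤ L) (M H K l d Q Q0 V wmax : ℕ) (B G e γ D : ℝ) (hM : 1 ≤ M)
    (hD : D = c * (c - 1) * (M:ℝ) ^ (c - 2)) (hwm : wmax = ⌊(V:ℝ) / (2 ^ d * D)⌋₊)
    (hB : 1 ≤ B) (hG : 1 ≤ G) (hK : 0 < K) (hQ1 : 1 ≤ Q) (hQK : Q * B ≤ K)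
    (hQ0 : 2 ^ l * 2 ^ d * B ≤ Q0) (hV : 0 < V)
    (he : 0 ≤ e) (he4 : e ≤ 1 / 4) (hH : (H:ℝ) ≤ e * M) (hwe : (wmax:ℝ) ≤ e * M)
    (heV : 2 * e * V + 2 ^ d * D ≤ 1) (hl : 2 * c * (M:ℝ) ^ (c - 1) ≤ 2 ^ l / G)
    (hKL : (2:ℝ) ^ d * (((K:ℝ) + L) ^ 2 * D) ≤ 1)
    (hwin : ∀ j, |∑ s ∈ Finset.range V, tmJ S d l (j + s)| ≤ γ * V * (2 ^ l * 2 ^ d)) :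
    |∑ n ∈ Finset.range H, tmProd S (fun x => ⌊((M + n + x : ℕ):ℝ) ^ c⌋₊)|
      ≤ (2 * K + H * (10 / B + 2 * S.card * (L + 1) / 2 ^ d + 2 * L / G)
        + 2 * (Q0 * (4 * 2 ^ l / ((Q + 1) * (D / 2)) + Q0)))
        + (2 * wmax + H * (2 * S.card * L / 2 ^ d + γ)) := by
  classical
  have hMr : (1:ℝ) ≤ M := by exact_mod_cast hM
  have hM0 : (0:ℝ) < M := by linarith
  have hcc : 0 < c * (c - 1) := mul_pos (by linarith) (by linarith)
  have hDpos : 0 < D := by rw [hD]; positivity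
  set f : ℕ → ℝ := fun n => (n:ℝ) ^ c with hf
  set α : ℕ → ℝ := fun n => c * (n:ℝ) ^ (c - 1) with hα
  have hα0 : ∀ n, 0 ≤ α n := fun n => by simp only [hα]; positivity
  have hDn : ∀ n : ℕ, c * (c - 1) * ((M + n : ℕ):ℝ) ^ (c - 2) ≤ D := by
    intro n
    rw [hD]
    have : ((M + n : ℕ):ℝ) ^ (c - 2) ≤ (M:ℝ) ^ (c - 2) := by
      apply Real.rpow_le_rpow_of_nonpos hM0 _ (by linarith)
      push_cast; linarith [(Nat.cast_nonneg n : (0:ℝ) ≤ n)]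
    gcongr
  have hpos : ∀ n : ℕ, (0:ℝ) < ((M + n : ℕ):ℝ) := fun n => by push_cast; positivity
  have hup : ∀ n w : ℕ, α (M + n + w) - α (M + n) ≤ D * w := by
    intro n w
    have h := der_upper c ((M + n : ℕ):ℝ) w hc1.le hc2 (hpos n) (by positivity)
    have h2 : c * (c - 1) * ((M + n : ℕ):ℝ) ^ (c - 2) * w ≤ D * w := by
      gcongr; exact hDn n
    simp only [hα]
    rw [Nat.cast_add (M + n) w]
    linarith
  have hlo : ∀ n w : ℕ, (n:ℝ) + w ≤ 2 * e * M → (1 - 2 * e) * D * w ≤ α (M + n + w) - α (M + n) := by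
    intro n w hnw
    have h := der_lower c ((M + n : ℕ):ℝ) w hc1.le hc2 (hpos n) (by positivity)
    have h3 := pow_compare c M (((M + n : ℕ):ℝ) + w) e hc1.le hM0 he
      (by push_cast; linarith [(Nat.cast_nonneg n : (0:ℝ) ≤ n), (Nat.cast_nonneg w : (0:ℝ) ≤ w)])
      (by push_cast; linarith)
    have h2 : (1 - 2 * e) * D * w ≤ c * (c - 1) * (((M + n : ℕ):ℝ) + w) ^ (c - 2) * w := by
      rw [hD]
      have : (1 - 2 * e) * (c * (c - 1) * (M:ℝ) ^ (c - 2))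
          = c * (c - 1) * ((1 - 2 * e) * (M:ℝ) ^ (c - 2)) := by ring
      rw [this]
      gcongr
    simp only [hα]
    rw [Nat.cast_add (M + n) w]
    linarith
  have hnH : ∀ n < H, (n:ℝ) ≤ e * M := by
    intro n hn
    have : (n:ℝ) ≤ H := by exact_mod_cast hn.le
    linarith
  have hαG : ∀ n < H, α (M + n) ≤ 2 ^ l / G := by
    intro n hn
    refine le_trans ?_ hl
    simp only [hα]
    have h1 : ((M + n : ℕ):ℝ) ≤ 2 * M := by
      push_cast; nlinarith [hnH n hn]
    have h2 : ((M + n : ℕ):ℝ) ^ (c - 1) ≤ 2 * (M:ℝ) ^ (c - 1) := by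
      calc _ ≤ (2 * (M:ℝ)) ^ (c - 1) := Real.rpow_le_rpow (by positivity) h1 (by linarith)
        _ = 2 ^ (c - 1) * (M:ℝ) ^ (c - 1) := Real.mul_rpow (by norm_num) hM0.le
        _ ≤ 2 ^ (1:ℝ) * (M:ℝ) ^ (c - 1) := by
          gcongr
          · norm_num
          · linarith
        _ = _ := by rw [Real.rpow_one]
    nlinarith
  have hbad := bad_count α M H (2 ^ l) (D / 2) Q Q0 hQ1 (by positivity) (by positivity)
    (fun n hn => ⟨hα0 _, (hαG n hn).trans (div_le_self (by positivity) hG)⟩)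
    (by
      intro n n' hnn hn'
      obtain ⟨w, rfl⟩ := Nat.exists_eq_add_of_le hnn
      have h1 := hnH _ hn'
      have h2 := hlo n w (by push_cast at h1; nlinarith)
      rw [← add_assoc]
      push_cast
      have h3 : D / 2 * (w:ℝ) ≤ (1 - 2 * e) * D * w := by
        have : 0 ≤ (1 / 2 - 2 * e) * (D * w) := mul_nonneg (by linarith) (by positivity)
        linarith
      have : D / 2 * ((n:ℝ) + w - n) = D / 2 * w := by ring
      linarith)
  have hA := stepA S hE L hL f α M H K l d Q Q0 B G _ hB (by linarith) hK hQ1 hQK hQ0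
    (fun n _ => by simp only [hf]; positivity) (fun n hn => ⟨hα0 _, hαG n hn⟩)
    (by
      intro n hn k hk
      have := pow_lower c ((M + n : ℕ):ℝ) k hc1.le (hpos n) (by positivity)
      simp only [hf, hα]
      rw [Nat.cast_add (M + n) k]
      exact this)
    (by
      intro n hn k hk
      have h1 := pow_upper c ((M + n : ℕ):ℝ) k hc1.le hc2 (hpos n) (by positivity)
      have h2 : (k:ℝ) ^ 2 * (c * (c - 1) * ((M + n : ℕ):ℝ) ^ (c - 2)) ≤ ((K:ℝ) + L) ^ 2 * D := by
        have hkk : (k:ℝ) ≤ K + L := by exact_mod_cast hk.le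
        gcongr
        exact hDn n
      simp only [hf, hα]
      rw [Nat.cast_add (M + n) k]
      calc _ ≤ (2:ℝ) ^ d * (((M + n : ℕ):ℝ) ^ c + k * (c * ((M + n : ℕ):ℝ) ^ (c - 1))
            + ((K:ℝ) + L) ^ 2 * D) := by gcongr; linarith
        _ ≤ _ := by rw [mul_add]; linarith)
    hbad
  set w : ℕ → ℕ := fun s => ⌊(s:ℝ) / (2 ^ d * D)⌋₊ with hw
  have hwle : ∀ s < V, w s ≤ wmax := by
    intro s hs
    rw [hwm]
    apply Nat.floor_mono
    have : (s:ℝ) ≤ V := by exact_mod_cast hs.le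
    gcongr
  have hdD : 0 < (2:ℝ) ^ d * D := by positivity
  have hBs := stepB S L hL α M H l d V wmax w γ hV hwle (fun n _ => hα0 _)
    (by
      intro n hn s hs
      have h1 : (w s : ℝ) ≤ wmax := by exact_mod_cast hwle s hs
      have h2 := hlo n (w s) (by nlinarith [hnH n hn])
      have h3 : (s:ℝ) / (2 ^ d * D) < w s + 1 := Nat.lt_floor_add_one _
      rw [div_lt_iff₀ hdD] at h3
      have h4 : (s:ℝ) ≤ V := by exact_mod_cast hs.le
      have h5 : (2:ℝ) ^ d * ((1 - 2 * e) * D * w s) ≤ 2 ^ d * (α (M + n + w s) - α (M + n)) := by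
        gcongr
      have h6 : (1 - 2 * e) * ((s:ℝ) - 2 ^ d * D) ≤ (1 - 2 * e) * (2 ^ d * D * w s) := by
        apply mul_le_mul_of_nonneg_left _ (by linarith)
        linarith
      have h7 : e * (s:ℝ) ≤ e * V := by gcongr
      have h8 : 0 ≤ e * (2 ^ d * D) := by positivity
      nlinarith)
    (by
      intro n hn s hs
      have h2 := hup n (w s)
      have h3 : (w s : ℝ) ≤ (s:ℝ) / (2 ^ d * D) := Nat.floor_le (by positivity)
      rw [le_div_iff₀ hdD] at h3
      have h5 : (2:ℝ) ^ d * (α (M + n + w s) - α (M + n)) ≤ 2 ^ d * (D * w s) := by gcongr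
      nlinarith)
    hwin
  have htri : ∀ a b x y : ℝ, |a - b| ≤ x → |b| ≤ y → |a| ≤ x + y := by
    intro a b x y h1 h2
    have : a = (a - b) + b := by ring
    rw [this]
    exact (abs_add_le _ _).trans (by linarith)
  exact htri _ _ _ _ hA hBs


lemma window_all (S : Finset ℕ) (m : ℕ) (hm1 : 1 ≤ m)
    (hm : ∀ b : ℕ → ℕ, (∀ l, b l ≤ l) →
      ∃ x0 x1 y0 : ℕ, x0 < 2 ^ m ∧ x1 < 2 ^ m ∧ y0 < 2 ^ m ∧ x0 ≠ x1 ∧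
        (∀ l ∈ S, x0 + l * y0 + b l < 2 ^ m) ∧ (∀ l ∈ S, x1 + l * y0 + b l < 2 ^ m) ∧
        tmProd S (fun l => x0 + l * y0 + b l) = - tmProd S (fun l => x1 + l * y0 + b l))
    (d t Bw : ℕ) (hBw : 1 ≤ Bw) (l : ℕ) (hl : m * t ≤ l) (j : ℕ) :
    |∑ s ∈ Finset.range (2 ^ d * 2 ^ (m * t) * Bw), tmJ S d l (j + s)|
      ≤ ((1 - 2 / 4 ^ m) ^ t + 2 / Bw) * ((2 ^ d * 2 ^ (m * t) * Bw : ℕ) : ℝ) * (2 ^ l * 2 ^ d) := by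
  have h := window_bound (fun j => tmJ S d l j) (2 ^ l * 2 ^ d) _ (abs_tmJ_le S d l)
    (by positivity) (2 ^ d * 2 ^ (m * t)) (by positivity)
    (tmJ_aligned S m d t l hl (contraction_shift S m d t (contraction S m hm1 hm t))) Bw j
  refine h.trans (le_of_eq ?_)
  have : (0:ℝ) < Bw := by exact_mod_cast hBw
  push_cast
  field_simp

open Filter in
lemma ev_lt (C p q δ : ℝ) (hpq : p < q) (hδ : 0 < δ) :
    ∀ᶠ M : ℕ in atTop, C * (M:ℝ) ^ p ≤ δ * (M:ℝ) ^ q := by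
  have h1 : Tendsto (fun M : ℕ => C * (M:ℝ) ^ (-(q - p))) atTop (nhds (C * 0)) :=
    ((tendsto_rpow_neg_atTop (sub_pos.mpr hpq)).comp tendsto_natCast_atTop_atTop).const_mul C
  rw [mul_zero] at h1
  filter_upwards [h1.eventually (gt_mem_nhds hδ), eventually_ge_atTop 1] with M hM hM1
  have hM0 : (0:ℝ) < M := by exact_mod_cast hM1
  have e : (M:ℝ) ^ p = (M:ℝ) ^ (-(q - p)) * (M:ℝ) ^ q := by
    rw [← Real.rpow_add hM0]; congr 1; ring
  rw [e, ← mul_assoc]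
  gcongr

open Filter in
set_option maxHeartbeats 2000000 in
lemma asym (c : ℝ) (hc1 : 1 < c) (hc2 : c < 4 / 3) (S : Finset ℕ) (hE : Even S.card) (L : ℕ)
    (hL : ∀ l ∈ S, l ≤ L) (d V B W0 : ℕ) (G e γ δ : ℝ) (hV : 0 < V) (hB : 1 ≤ B) (hG : 1 ≤ G)
    (he : 0 < e) (he4 : e ≤ 1 / 4) (heV : 2 * e * V ≤ 1 / 2) (hδ : 0 < δ)
    (hwin : ∀ l, W0 ≤ l → ∀ j, |∑ s ∈ Finset.range V, tmJ S d l (j + s)|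
      ≤ γ * V * (2 ^ l * 2 ^ d)) :
    ∀ᶠ M : ℕ in atTop, ∃ H : ℕ, 1 ≤ H ∧ (H:ℝ) ≤ e * M ∧
      |∑ n ∈ Finset.range H, tmProd S (fun x => ⌊((M + n + x : ℕ):ℝ) ^ c⌋₊)|
      ≤ H * (10 / B + 2 * S.card * (L + 1) / 2 ^ d + 2 * L / G + 2 * S.card * L / 2 ^ d + γ
        + 4 * δ) := by
  have hA : 0 < c * (c - 1) := mul_pos (by linarith) (by linarith)
  set A := c * (c - 1) with hAdef
  have hGp : 0 < G := by linarith
  have hBr : (1:ℝ) ≤ B := by exact_mod_cast hB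
  set C8 : ℝ := 4 * G * c * 2 ^ d * B with hC8
  set C9 : ℝ := 32 * G * c * B / A with hC9
  have hcp : 0 < c := by linarith
  have hδe : 0 < δ * e / 2 := by positivity
  filter_upwards [eventually_ge_atTop 1, ev_lt (2 / e) 0 1 1 (by norm_num) (by norm_num),
    ev_lt (V / (2 ^ d * A)) (2 - c) 1 e (by linarith) he,
    ev_lt (2 * (V / (2 ^ d * A))) (2 - c) 1 (δ * e / 2) (by linarith) hδe,
    ev_lt (2 ^ d * A) (c - 2) 0 (1 / 2) (by linarith) (by norm_num),
    ev_lt (2 ^ W0 + 1) 0 (c - 1) (2 * G * c) (by linarith) (by positivity),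
    ev_lt (L:ℝ) 0 (c / 4) 1 (by linarith) (by norm_num),
    ev_lt (B:ℝ) 0 (c / 4) 1 (by linarith) (by norm_num),
    ev_lt (2 ^ d * (4 * A)) (c / 4 + c / 4 + (c - 2)) 0 1 (by linarith) (by norm_num),
    ev_lt 2 (c / 4) 1 (δ * e / 2) (by linarith) hδe,
    ev_lt (2 * (C8 * C9)) (c - 1 + (1 - c / 4)) 1 (δ * e / 2) (by linarith) hδe,
    ev_lt (2 * (C8 * C8)) (c - 1 + (c - 1)) 1 (δ * e / 2) (by linarith) hδe]
    with M hM1 h1 h2 h3 h4 h5 h6 h7 h8 h9 h10 h11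
  simp only [Real.rpow_zero, Real.rpow_one, mul_one, one_mul] at h1 h2 h3 h4 h5 h6 h7 h8 h9 h10 h11
  have hM0 : (0:ℝ) < M := by exact_mod_cast hM1
  have h1' : 2 ≤ e * M := by rw [div_le_iff₀ he] at h1; linarith
  set H := ⌊e * (M:ℝ)⌋₊ with hH
  have hHle : (H:ℝ) ≤ e * M := Nat.floor_le (by positivity)
  have hHge : e * M / 2 ≤ (H:ℝ) := by
    have := Nat.lt_floor_add_one (e * (M:ℝ))
    rw [← hH] at this
    linarith
  have hHge1 : (1:ℝ) ≤ H := by linarith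
  refine ⟨H, by exact_mod_cast hHge1, hHle, ?_⟩
  set D := A * (M:ℝ) ^ (c - 2) with hD
  have hDpos : 0 < D := by positivity
  -- the modulus
  set x := 2 * G * c * (M:ℝ) ^ (c - 1) with hx
  have hx1 : 1 ≤ x := by
    have : (0:ℝ) ≤ 2 ^ W0 := by positivity
    linarith
  obtain ⟨l0, hl0, hl1⟩ := exists_nat_pow_near hx1 (by norm_num : (1:ℝ) < 2)
  set l := l0 + 1 with hl
  have hl2 : (2:ℝ) ^ l ≤ 4 * G * c * (M:ℝ) ^ (c - 1) := by
    rw [hl, pow_succ]; rw [hx] at hl0; linarith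
  have hW0 : W0 ≤ l := by
    by_contra hcon
    push Not at hcon
    have : (2:ℝ) ^ l ≤ 2 ^ W0 := pow_le_pow_right₀ (by norm_num) hcon.le
    linarith
  have hlG : 2 * c * (M:ℝ) ^ (c - 1) ≤ 2 ^ l / G := by
    rw [le_div_iff₀ hGp]; rw [hx] at hl1; linarith
  -- the lengths
  set K := ⌊(M:ℝ) ^ (c / 4)⌋₊ with hK
  have hKle : (K:ℝ) ≤ (M:ℝ) ^ (c / 4) := Nat.floor_le (by positivity)
  have hKgt : (M:ℝ) ^ (c / 4) < K + 1 := Nat.lt_floor_add_one _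
  have hBK : B ≤ K := Nat.le_floor h7
  have hQ1 : 1 ≤ K / B := (Nat.one_le_div_iff (by omega)).mpr hBK
  have hQK : ((K / B : ℕ):ℝ) * B ≤ K := by exact_mod_cast Nat.div_mul_le_self K B
  have hQlow : (M:ℝ) ^ (c / 4) / B ≤ ((K / B : ℕ):ℝ) + 1 := by
    rw [div_le_iff₀ (by linarith)]
    have : K + 1 ≤ (K / B + 1) * B := by
      have := Nat.lt_div_mul_add (a := K) (b := B) (by omega)
      rw [add_mul, one_mul]; omega
    have h' : ((K:ℝ) + 1) ≤ (((K / B : ℕ):ℝ) + 1) * B := by exact_mod_cast this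
    linarith
  have hwm : (⌊(V:ℝ) / (2 ^ d * D)⌋₊ : ℝ) ≤ V / (2 ^ d * A) * (M:ℝ) ^ (2 - c) := by
    refine (Nat.floor_le (by positivity)).trans (le_of_eq ?_)
    rw [hD, show 2 - c = -(c - 2) by ring, Real.rpow_neg hM0.le]
    field_simp
  have hKL : (2:ℝ) ^ d * (((K:ℝ) + L) ^ 2 * D) ≤ 1 := by
    have hs : (K:ℝ) + L ≤ 2 * (M:ℝ) ^ (c / 4) := by linarith
    calc (2:ℝ) ^ d * (((K:ℝ) + L) ^ 2 * D) ≤ 2 ^ d * ((2 * (M:ℝ) ^ (c / 4)) ^ 2 * D) := by gcongr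
      _ = 2 ^ d * (4 * A) * (M:ℝ) ^ (c / 4 + c / 4 + (c - 2)) := by
        rw [Real.rpow_add hM0, Real.rpow_add hM0, hD]; ring
      _ ≤ 1 := h8
  have hcore := core c hc1 (by linarith) S hE L hL M H K l d (K / B) (2 ^ l * 2 ^ d * B) V
    ⌊(V:ℝ) / (2 ^ d * D)⌋₊ B G e γ D hM1 hD rfl hBr hG (by omega) hQ1 hQK (by push_cast; rfl) hV
    he.le he4 hHle (hwm.trans h2) (by rw [hD]; linarith) hlG hKL (hwin l hW0)
  refine hcore.trans ?_
  -- bounding the number of bad points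
  have hQ0 : ((2 ^ l * 2 ^ d * B : ℕ):ℝ) ≤ C8 * (M:ℝ) ^ (c - 1) := by
    push_cast
    calc (2:ℝ) ^ l * 2 ^ d * B ≤ (4 * G * c * (M:ℝ) ^ (c - 1)) * 2 ^ d * B := by gcongr
      _ = _ := by rw [hC8]; ring
  have hfr : 4 * (2:ℝ) ^ l / ((((K / B : ℕ):ℝ) + 1) * (D / 2)) ≤ C9 * (M:ℝ) ^ (1 - c / 4) := by
    calc 4 * (2:ℝ) ^ l / ((((K / B : ℕ):ℝ) + 1) * (D / 2))
        ≤ 4 * (4 * G * c * (M:ℝ) ^ (c - 1)) / ((M:ℝ) ^ (c / 4) / B * (D / 2)) := by gcongr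
      _ = C9 * ((M:ℝ) ^ (c - 1) / ((M:ℝ) ^ (c / 4) * (M:ℝ) ^ (c - 2))) := by
        rw [hC9, hD]; field_simp; ring
      _ = _ := by
        rw [← Real.rpow_add hM0, ← Real.rpow_sub hM0]; congr 2; ring
  have hC8p : 0 < C8 := by positivity
  have hC9p : 0 < C9 := by positivity
  have hbd : 2 * (((2 ^ l * 2 ^ d * B : ℕ):ℝ) * (4 * (2:ℝ) ^ l / ((((K / B : ℕ):ℝ) + 1) * (D / 2))
      + ((2 ^ l * 2 ^ d * B : ℕ):ℝ))) ≤ δ * e / 2 * M + δ * e / 2 * M := by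
    calc _ ≤ 2 * ((C8 * (M:ℝ) ^ (c - 1)) * (C9 * (M:ℝ) ^ (1 - c / 4) + C8 * (M:ℝ) ^ (c - 1))) := by
          gcongr
      _ = 2 * (C8 * C9) * (M:ℝ) ^ (c - 1 + (1 - c / 4)) + 2 * (C8 * C8) * (M:ℝ) ^ (c - 1 + (c - 1)) := by
          rw [Real.rpow_add hM0, Real.rpow_add hM0]; ring
      _ ≤ _ := add_le_add h10 h11
  have hδH : δ * e / 2 * M ≤ δ * H := by
    have := mul_le_mul_of_nonneg_left hHge hδ.le
    linarith
  have hw2 : 2 * (⌊(V:ℝ) / (2 ^ d * D)⌋₊ : ℝ) ≤ δ * H := by linarith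
  have hK2 : 2 * (K:ℝ) ≤ δ * H := by linarith
  have hb2 := hbd.trans (add_le_add hδH hδH)
  calc _ ≤ (δ * H + H * (10 / B + 2 * S.card * (L + 1) / 2 ^ d + 2 * L / G) + (δ * H + δ * H))
        + (δ * H + H * (2 * S.card * L / 2 ^ d + γ)) :=
        add_le_add (add_le_add (add_le_add hK2 le_rfl) hb2) (add_le_add hw2 le_rfl)
    _ = _ := by ring

open Filter in
set_option maxHeartbeats 2000000 in
lemma even_case (c : ℝ) (hc1 : 1 < c) (hc2 : c < 4 / 3) (S : Finset ℕ) (hS : S.Nonempty)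
    (hE : Even S.card) :
    Tendsto (fun N : ℕ => (∑ n ∈ Finset.range N,
      tmProd S (fun x => ⌊((n + x : ℕ):ℝ) ^ c⌋₊)) / N) atTop (nhds 0) := by
  refine walk _ (fun n => (abs_tmProd _ _).le) (fun η hη => ?_)
  obtain ⟨m, hm1, hm⟩ := exists_cancel S hS hE
  set L := S.max' hS
  have hL : ∀ l ∈ S, l ≤ L := fun l hl => S.le_max' l hl
  set δ := η / 20 with hδ
  have hδp : 0 < δ := by positivity
  have hq0 : (0:ℝ) ≤ 1 - 2 / 4 ^ m := by
    have : (4:ℝ) ^ 1 ≤ 4 ^ m := pow_le_pow_right₀ (by norm_num) hm1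
    rw [sub_nonneg, div_le_one (by positivity)]; linarith
  have hq1 : (1:ℝ) - 2 / 4 ^ m < 1 := by
    have : (0:ℝ) < 2 / 4 ^ m := by positivity
    linarith
  obtain ⟨t, ht⟩ := exists_pow_lt_of_lt_one hδp hq1
  obtain ⟨d, hd⟩ := pow_unbounded_of_one_lt (2 * (S.card:ℝ) * (L + 1) / δ) (by norm_num : (1:ℝ) < 2)
  obtain ⟨Bw, hBw⟩ := exists_nat_gt (2 / δ)
  obtain ⟨B, hB⟩ := exists_nat_gt (10 / δ)
  have hBwp : (0:ℝ) < Bw := lt_trans (by positivity) hBw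
  have hBp : (0:ℝ) < B := lt_trans (by positivity) hB
  have hBw1 : 1 ≤ Bw := by exact_mod_cast hBwp
  have hB1 : 1 ≤ B := by exact_mod_cast hBp
  set V := 2 ^ d * 2 ^ (m * t) * Bw with hVdef
  have hV : 0 < V := by positivity
  have hVr : (0:ℝ) < V := by exact_mod_cast hV
  set e := min η (min (1 / 4) (1 / (4 * (V:ℝ)))) with he
  have hep : 0 < e := by
    rw [he]; exact lt_min hη (lt_min (by norm_num) (by positivity))
  have he1 : e ≤ η := min_le_left _ _
  have he2 : e ≤ 1 / 4 := (min_le_right _ _).trans (min_le_left _ _)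
  have he3 : e ≤ 1 / (4 * (V:ℝ)) := (min_le_right _ _).trans (min_le_right _ _)
  rw [le_div_iff₀ (by positivity)] at he3
  have hev := asym c hc1 hc2 S hE L hL d V B (m * t) (2 * L / δ + 1) e
    ((1 - 2 / 4 ^ m) ^ t + 2 / Bw) δ hV hB1
    (by have : 0 ≤ 2 * (L:ℝ) / δ := by positivity
        linarith) hep he2 (by linarith) hδp
    (fun l hl j => window_all S m hm1 hm d t Bw hBw1 l hl j)
  obtain ⟨M0, hM0⟩ := eventually_atTop.mp hev
  refine ⟨M0, fun M hM => ?_⟩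
  obtain ⟨H, hH1, hH2, hH3⟩ := hM0 M hM
  refine ⟨H, hH1, hH2.trans (by gcongr), hH3.trans ?_⟩
  have b1 : 10 / (B:ℝ) ≤ δ := by
    rw [div_lt_iff₀ hδp] at hB
    rw [div_le_iff₀ hBp]; linarith
  have b2 : 2 / (Bw:ℝ) ≤ δ := by
    rw [div_lt_iff₀ hδp] at hBw
    rw [div_le_iff₀ hBwp]; linarith
  have b3 : 2 * (S.card:ℝ) * (L + 1) / 2 ^ d ≤ δ := by
    rw [div_lt_iff₀ hδp] at hd
    rw [div_le_iff₀ (by positivity)]; linarith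
  have b4 : 2 * (S.card:ℝ) * L / 2 ^ d ≤ δ := by
    refine le_trans ?_ b3
    gcongr; linarith
  have b5 : 2 * (L:ℝ) / (2 * L / δ + 1) ≤ δ := by
    rw [div_le_iff₀ (by positivity), mul_add, mul_div_cancel₀ _ hδp.ne']; linarith
  have : 10 / (B:ℝ) + 2 * S.card * (L + 1) / 2 ^ d + 2 * L / (2 * L / δ + 1)
      + 2 * S.card * L / 2 ^ d + ((1 - 2 / 4 ^ m) ^ t + 2 / Bw) + 4 * δ ≤ η := by
    linarith
  rw [mul_comm η]
  gcongr

theorem stmt_6 (c : ℝ) (hc : 1 < c ∧ c < 4 / 3) (T : ℕ) (hT : 1 ≤ T)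
    (ε : ℕ → ℕ) (hε : ∀ ℓ < T, ε ℓ = 0 ∨ ε ℓ = 1) :
    Filter.Tendsto
      (fun N : ℕ =>
        (((Finset.range N).filter
            (fun n => ∀ ℓ < T, thueMorse (Nat.floor (((n + ℓ : ℕ) : ℝ) ^ c)) = ε ℓ)).card : ℝ) / N)
      Filter.atTop (nhds (1 / 2 ^ T)) := by
  have hev : ∀ S : Finset ℕ, S.Nonempty → Even S.card →
      Filter.Tendsto (fun N : ℕ => (∑ n ∈ Finset.range N,
        tmProd S (fun x => (fun k : ℕ => ⌊(k:ℝ) ^ c⌋₊) (n + x))) / N)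
        Filter.atTop (nhds 0) := fun S hS hE => even_case c hc.1 hc.2 S hS hE
  have hall := odd_of_even (fun k : ℕ => ⌊(k:ℝ) ^ c⌋₊) hev
  have := normal_of_corr (fun k : ℕ => ⌊(k:ℝ) ^ c⌋₊) T ε hε hall
  refine this.congr (fun N => ?_)
  congr 2
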